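/- arXiv:2408.05872 — 3 statements merged into one kernel-verified Lean document; each statement's English description precedes it below -/
import Mathlib

section
/- Let q be an odd prime, let l ≥ 1, and let a_1, a_2, …, a_l be non-zero q-free integers, none of which equals 1 or -1. Let p_1, p_2, …, p_k (with k ≥ 2) be all the distinct primes dividing the product a_1·a_2⋯a_l, and for each 1 ≤ i ≤ k and 1 ≤ j ≤ l let ν_{ij} ≥ 0 be the natural number with p_i^{ν_{ij}} exactly dividing a_j. Then the polynomial f(x) = (x^q − a_1)(x^q − a_2)⋯(x^q − a_l) has a root modulo every positive integer if and only if the following three conditions all hold: (1) for every vector (x_1, …, x_k) ∈ (ℤ/qℤ)^k there exists some j ∈ {1, …, l} with ν_{1j}·x_1 + ν_{2j}·x_2 + ⋯ + ν_{kj}·x_k = 0 in ℤ/qℤ; (2) there exists j ∈ {1, …, l} such that a_j is a q-th power modulo q^q; (3) for every i ∈ {1, …, k} there exists j ∈ {1, …, l} such that p_i does not divide a_j and a_j is a q-th power modulo p_i. -/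
namespace PowerIntersective

open NumberField Filter Topology Finset

lemma sum_multiset_prod_le {ι : Type*} [DecidableEq ι] (x : ι → ℝ) (hx0 : ∀ i, 0 ≤ x i)
    (S : Finset ι) (hx1 : ∀ i ∈ S, x i < 1) (A : Finset (Multiset ι))
    (hA : ∀ m ∈ A, ∀ i ∈ m, i ∈ S) :
    ∑ m ∈ A, (m.map x).prod ≤ ∏ i ∈ S, (1 - x i)⁻¹ := by
  classical
  obtain ⟨n, hn⟩ : ∃ n, ∀ m ∈ A, Multiset.card m < n :=
    ⟨A.sup Multiset.card + 1, fun m hm ↦ Nat.lt_succ_of_le (Finset.le_sup (f := Multiset.card) hm)⟩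
  have h1 : ∀ m ∈ A, (m.map x).prod = ∏ i ∈ S.attach, x i ^ (m.count i.1) := by
    intro m hm
    rw [Finset.prod_multiset_map_count, Finset.prod_attach S (fun i ↦ x i ^ m.count i)]
    refine Finset.prod_subset (fun i hi ↦ hA m hm i (by simpa using hi)) fun i _ hi ↦ ?_
    rw [Multiset.count_eq_zero_of_notMem (by simpa using hi), pow_zero]
  have h2 : ∀ i ∈ S, ∑ e ∈ range n, x i ^ e ≤ (1 - x i)⁻¹ := fun i hi ↦ by
    rw [← tsum_geometric_of_lt_one (hx0 i) (hx1 i hi)]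
    exact (summable_geometric_of_lt_one (hx0 i) (hx1 i hi)).sum_le_tsum _
      fun e _ ↦ pow_nonneg (hx0 i) e
  refine le_trans ?_ (Finset.prod_le_prod (fun i _ ↦ Finset.sum_nonneg
    fun e _ ↦ pow_nonneg (hx0 i) e) h2)
  rw [Finset.prod_sum, Finset.sum_congr rfl h1]
  have hinj : Set.InjOn (fun (m : Multiset ι) (i : ι) (_ : i ∈ S) ↦ m.count i) A := by
    intro m hm m' hm' h
    ext i
    by_cases hi : i ∈ S
    · exact congrFun (congrFun h i) hi
    · rw [Multiset.count_eq_zero_of_notMem fun h ↦ hi (hA m hm i h),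
        Multiset.count_eq_zero_of_notMem fun h ↦ hi (hA m' hm' i h)]
  rw [← Finset.sum_image (g := fun (m : Multiset ι) (i : ι) (_ : i ∈ S) ↦ m.count i)
    (f := fun p ↦ ∏ i ∈ S.attach, x i ^ p i i.2) hinj]
  refine Finset.sum_le_sum_of_subset_of_nonneg ?_ fun p _ _ ↦
    Finset.prod_nonneg fun i _ ↦ pow_nonneg (hx0 i) _
  intro p hp
  obtain ⟨m, hm, rfl⟩ := Finset.mem_image.1 hp
  exact Finset.mem_pi.2 fun i _ ↦ Finset.mem_range.2 ((Multiset.count_le_card i m).trans_lt (hn m hm))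

lemma inv_one_sub_le_exp {x : ℝ} (h1 : x ≤ 1 / 2) :
    (1 - x)⁻¹ ≤ Real.exp (x + 2 * x ^ 2) := by
  have h2 : (1 - x)⁻¹ ≤ 1 + (x + 2 * x ^ 2) := by
    rw [inv_le_iff_one_le_mul₀ (by linarith)]
    nlinarith [mul_nonneg (sq_nonneg x) (by linarith : 0 ≤ 1 - 2 * x)]
  exact h2.trans (by linarith [Real.add_one_le_exp (x + 2 * x ^ 2)])

lemma exp_sub_sq_le_one_add {x : ℝ} (h0 : 0 ≤ x) : Real.exp (x - x ^ 2) ≤ 1 + x := by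
  by_cases h1 : x ≤ 1
  · have h2 := Real.add_one_le_exp (-(x - x ^ 2))
    rw [Real.exp_neg] at h2
    have h3 : 0 < -(x - x ^ 2) + 1 := by nlinarith
    have h4 := inv_anti₀ h3 h2
    rw [inv_inv] at h4
    refine h4.trans ?_
    rw [inv_le_iff_one_le_mul₀ h3]
    nlinarith [pow_nonneg h0 3]
  · have h2 : Real.exp (x - x ^ 2) ≤ 1 := Real.exp_le_one_iff.2 (by nlinarith)
    linarith

lemma summable_absNorm_rpow_of_dedekindZeta_ne_zero (K : Type*) [Field K] [NumberField K] {s : ℝ}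
    (hs : 1 < s) (h : dedekindZeta K s ≠ 0) :
    Summable (fun I : Ideal (𝓞 K) ↦ (Ideal.absNorm I : ℝ) ^ (-s)) ∧
      dedekindZeta K s = ((∑' I : Ideal (𝓞 K), (Ideal.absNorm I : ℝ) ^ (-s) : ℝ) : ℂ) := by
  have h0 : ∀ I : Ideal (𝓞 K), 0 ≤ (Ideal.absNorm I : ℝ) ^ (-s) := fun I ↦ by positivity
  set c : ℕ → ℝ := fun n ↦ Nat.card {I : Ideal (𝓞 K) // Ideal.absNorm I = n} * (n : ℝ) ^ (-s)
  have hterm : ∀ n : ℕ, LSeries.term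
      (fun n ↦ (Nat.card {I : Ideal (𝓞 K) // Ideal.absNorm I = n} : ℂ)) s n = (c n : ℂ) := by
    intro n
    rw [LSeries.term_def]
    split_ifs with hn
    · simp [c, hn, Real.zero_rpow (show -s ≠ 0 by linarith)]
    · simp only [c]
      push_cast
      rw [Complex.ofReal_cpow (by positivity)]
      push_cast
      rw [Complex.cpow_neg, div_eq_mul_inv]
  have hsum : Summable c := by
    by_contra hc
    refine h ?_
    rw [dedekindZeta, LSeries, tsum_congr hterm, ← Complex.ofReal_tsum, tsum_eq_zero_of_not_summable hc,
      Complex.ofReal_zero]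
  have hfib : ∀ n : ℕ, HasSum (fun I : {I : Ideal (𝓞 K) // Ideal.absNorm I = n} ↦
      (Ideal.absNorm (Equiv.sigmaFiberEquiv Ideal.absNorm ⟨n, I⟩) : ℝ) ^ (-s)) (c n) := by
    intro n
    have : Finite {I : Ideal (𝓞 K) // Ideal.absNorm I = n} :=
      (Ideal.finite_setOfPred_absNorm_eq n)
    have := Fintype.ofFinite {I : Ideal (𝓞 K) // Ideal.absNorm I = n}
    convert hasSum_fintype (fun I : {I : Ideal (𝓞 K) // Ideal.absNorm I = n} ↦
      (Ideal.absNorm (Equiv.sigmaFiberEquiv Ideal.absNorm ⟨n, I⟩) : ℝ) ^ (-s)) using 1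
    simp only [Equiv.sigmaFiberEquiv_apply, c]
    rw [Finset.sum_congr rfl fun I _ ↦ by rw [I.2]]
    simp
  have hsig : Summable fun x : (n : ℕ) × {I : Ideal (𝓞 K) // Ideal.absNorm I = n} ↦
      (Ideal.absNorm (Equiv.sigmaFiberEquiv Ideal.absNorm x) : ℝ) ^ (-s) := by
    refine (summable_sigma_of_nonneg fun x ↦ h0 _).2 ⟨fun n ↦ (hfib n).summable, ?_⟩
    convert hsum with n
    exact (hfib n).tsum_eq
  refine ⟨(Equiv.summable_iff (Equiv.sigmaFiberEquiv Ideal.absNorm)).1 hsig, ?_⟩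
  rw [dedekindZeta, LSeries, tsum_congr hterm, ← Complex.ofReal_tsum,
    ← (Equiv.sigmaFiberEquiv (Ideal.absNorm (S := 𝓞 K))).tsum_eq,
    ← (hsig.hasSum.sigma hfib).tsum_eq]

lemma eventually_summable_absNorm_rpow (K : Type*) [Field K] [NumberField K] :
    ∀ᶠ s : ℝ in 𝓝[>] 1, Summable (fun I : Ideal (𝓞 K) ↦ (Ideal.absNorm I : ℝ) ^ (-s)) ∧
      dedekindZeta K s = ((∑' I : Ideal (𝓞 K), (Ideal.absNorm I : ℝ) ^ (-s) : ℝ) : ℂ) := by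
  have h := (tendsto_sub_one_mul_dedekindZeta_nhdsGT K).eventually_ne
    (Complex.ofReal_ne_zero.2 (dedekindZeta_residue_ne_zero K))
  filter_upwards [h, self_mem_nhdsWithin] with s hs hs1
  exact summable_absNorm_rpow_of_dedekindZeta_ne_zero K hs1 (right_ne_zero_of_mul hs)

lemma tendsto_sub_one_mul_tsum_absNorm_rpow (K : Type*) [Field K] [NumberField K] :
    Tendsto (fun s : ℝ ↦ (s - 1) * ∑' I : Ideal (𝓞 K), (Ideal.absNorm I : ℝ) ^ (-s))
      (𝓝[>] 1) (𝓝 (dedekindZeta_residue K)) := by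
  have h := (Complex.continuous_re.tendsto _).comp (tendsto_sub_one_mul_dedekindZeta_nhdsGT K)
  rw [Complex.ofReal_re] at h
  refine h.congr' ?_
  filter_upwards [eventually_summable_absNorm_rpow K] with s hs
  rw [Function.comp_apply, hs.2, ← Complex.ofReal_one, ← Complex.ofReal_sub, ← Complex.ofReal_mul,
    Complex.ofReal_re]

lemma card_le_finrank_of_natCast_mem (K : Type*) [Field K] [NumberField K] {p : ℕ} (hp : p.Prime)
    (T : Finset (Ideal (𝓞 K))) (hT : ∀ P ∈ T, Prime P ∧ (p : 𝓞 K) ∈ P ∧ p ≤ Ideal.absNorm P) :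
    T.card ≤ Module.finrank ℚ K := by
  have h1 : ∏ P ∈ T, P ∣ Ideal.span {(p : 𝓞 K)} :=
    Finset.prod_primes_dvd _ (fun P hP ↦ (hT P hP).1) fun P hP ↦
      (Ideal.dvd_span_singleton).2 (hT P hP).2.1
  have h2 := Ideal.absNorm_dvd_absNorm_of_le (Ideal.le_of_dvd h1)
  rw [map_prod, Ideal.absNorm_span_natCast] at h2
  have h3 := Nat.le_of_dvd (pow_pos hp.pos _) h2
  rw [RingOfIntegers.rank] at h3
  have h4 : p ^ T.card ≤ ∏ P ∈ T, Ideal.absNorm P := by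
    rw [← Finset.prod_const]
    exact Finset.prod_le_prod' fun P hP ↦ (hT P hP).2.2
  exact (Nat.pow_le_pow_iff_right hp.one_lt).1 (h4.trans h3)

lemma exists_prime_mem_absNorm_eq_pow {K : Type*} [Field K] [NumberField K] {P : Ideal (𝓞 K)}
    (hP : Prime P) : ∃ p n : ℕ, p.Prime ∧ n ≠ 0 ∧ (p : 𝓞 K) ∈ P ∧ Ideal.absNorm P = p ^ n := by
  have hP' : P.IsPrime := Ideal.isPrime_of_prime hP
  have hmax : P.IsMaximal := hP'.isMaximal hP.ne_zero
  let _ := Ideal.Quotient.field P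
  have : Finite (𝓞 K ⧸ P) := Ideal.finiteQuotientOfFreeOfNeBot P hP.ne_zero
  have := Fintype.ofFinite (𝓞 K ⧸ P)
  obtain ⟨p, hc⟩ := CharP.exists (𝓞 K ⧸ P)
  obtain ⟨n, hp, hn⟩ := FiniteField.card (𝓞 K ⧸ P) p
  refine ⟨p, n, hp, n.ne_zero, ?_, ?_⟩
  · rw [← Ideal.Quotient.eq_zero_iff_mem, map_natCast, CharP.cast_eq_zero]
  · rw [← hn, Ideal.absNorm_apply, Submodule.cardQuot_apply, Nat.card_eq_fintype_card]

lemma exists_sum_inv_absNorm_le (K : Type*) [Field K] [NumberField K] : ∃ C : ℝ,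
    ∀ S : Finset (Ideal (𝓞 K)), (∀ P ∈ S, Prime P ∧ ¬ (Ideal.absNorm P).Prime) →
      ∑ P ∈ S, (Ideal.absNorm P : ℝ)⁻¹ ≤ C := by
  classical
  refine ⟨∑' p : ℕ, Module.finrank ℚ K * ((p : ℝ) ^ 2)⁻¹, fun S hS ↦ ?_⟩
  have h : ∀ P : Ideal (𝓞 K), ∃ p : ℕ, P ∈ S → p.Prime ∧ (p : 𝓞 K) ∈ P ∧
      p ^ 2 ≤ Ideal.absNorm P := by
    intro P
    by_cases hPS : P ∈ S
    · obtain ⟨p, n, hp, hn, hpP, hnorm⟩ := exists_prime_mem_absNorm_eq_pow (hS P hPS).1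
      refine ⟨p, fun _ ↦ ⟨hp, hpP, ?_⟩⟩
      rw [hnorm]
      refine Nat.pow_le_pow_right hp.pos ?_
      have : n ≠ 1 := by
        rintro rfl
        exact (hS P hPS).2 (by rwa [hnorm, pow_one])
      omega
    · exact ⟨0, fun h ↦ absurd h hPS⟩
  choose f hf using h
  have hsum : Summable fun p : ℕ ↦ (Module.finrank ℚ K : ℝ) * ((p : ℝ) ^ 2)⁻¹ :=
    (Real.summable_nat_pow_inv.2 one_lt_two).mul_left _
  refine le_trans ?_ (hsum.sum_le_tsum (S.image f) fun p _ ↦ by positivity)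
  rw [← Finset.sum_fiberwise_of_maps_to (t := S.image f) fun P hP ↦ Finset.mem_image_of_mem f hP]
  refine Finset.sum_le_sum fun p hp ↦ ?_
  obtain ⟨P₀, hP₀, rfl⟩ := Finset.mem_image.1 hp
  have hprime := (hf P₀ hP₀).1
  have hcard : (S.filter fun P ↦ f P = f P₀).card ≤ Module.finrank ℚ K := by
    refine card_le_finrank_of_natCast_mem K hprime _ fun P hP ↦ ?_
    rw [Finset.mem_filter] at hP
    obtain ⟨-, h2, h3⟩ := hf P hP.1
    rw [hP.2] at h2 h3
    exact ⟨(hS P hP.1).1, h2, (Nat.le_self_pow two_ne_zero _).trans h3⟩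
  calc ∑ P ∈ S with f P = f P₀, (Ideal.absNorm P : ℝ)⁻¹
      ≤ ∑ P ∈ S with f P = f P₀, ((f P₀ : ℝ) ^ 2)⁻¹ := by
        refine Finset.sum_le_sum fun P hP ↦ ?_
        rw [Finset.mem_filter] at hP
        have h3 := (hf P hP.1).2.2
        rw [hP.2] at h3
        have : (0 : ℝ) < f P₀ := by exact_mod_cast hprime.pos
        exact inv_anti₀ (by positivity) (by exact_mod_cast h3)
    _ ≤ _ := by
        rw [Finset.sum_const, nsmul_eq_mul]
        gcongr

lemma absNorm_rpow_eq_prod_normalizedFactors {K : Type*} [Field K] [NumberField K]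
    {I : Ideal (𝓞 K)} (hI : I ≠ ⊥) (s : ℝ) : (Ideal.absNorm I : ℝ) ^ s =
      ((UniqueFactorizationMonoid.normalizedFactors I).map
        fun P ↦ (Ideal.absNorm P : ℝ) ^ s).prod := by
  conv_lhs => rw [← Ideal.prod_normalizedFactors_eq_self hI]
  induction UniqueFactorizationMonoid.normalizedFactors I using Multiset.induction_on with
  | empty => simp
  | cons P m ih =>
    rw [Multiset.prod_cons, map_mul, Nat.cast_mul, Real.mul_rpow (by positivity) (by positivity), ih,
      Multiset.map_cons, Multiset.prod_cons]

lemma two_le_absNorm_of_prime {K : Type*} [Field K] [NumberField K] {P : Ideal (𝓞 K)}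
    (hP : Prime P) : 2 ≤ Ideal.absNorm P := by
  obtain ⟨p, n, hp, hn, -, h⟩ := exists_prime_mem_absNorm_eq_pow hP
  rw [h]
  exact hp.two_le.trans (Nat.le_self_pow hn p)

lemma absNorm_rpow_neg_le_half {K : Type*} [Field K] [NumberField K] {P : Ideal (𝓞 K)}
    (hP : Prime P) {s : ℝ} (hs : 1 ≤ s) : (Ideal.absNorm P : ℝ) ^ (-s) ≤ 1 / 2 := by
  have h2 : (2 : ℝ) ≤ Ideal.absNorm P := by exact_mod_cast two_le_absNorm_of_prime hP
  calc (Ideal.absNorm P : ℝ) ^ (-s) ≤ (Ideal.absNorm P : ℝ) ^ (-1 : ℝ) :=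
        Real.rpow_le_rpow_of_exponent_le (by linarith) (by linarith)
    _ = (Ideal.absNorm P : ℝ)⁻¹ := Real.rpow_neg_one _
    _ ≤ 1 / 2 := by
        rw [one_div]
        exact inv_anti₀ (by norm_num) h2

/-- The sum of the squares of the Euler factor parameters stays bounded as `s` tends to `1`. -/
lemma exists_sum_sq_absNorm_rpow_le (K : Type*) [Field K] [NumberField K] : ∃ C : ℝ,
    ∀ s : ℝ, 1 < s → ∀ S : Finset (Ideal (𝓞 K)), (∀ P ∈ S, Prime P) →
      ∑ P ∈ S, ((Ideal.absNorm P : ℝ) ^ (-s)) ^ 2 ≤ C := by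
  obtain ⟨t, ⟨ht, -⟩, -, ht2⟩ := ((eventually_summable_absNorm_rpow K).and
    (Ioo_mem_nhdsGT (show (1 : ℝ) < 2 by norm_num))).exists
  refine ⟨_, fun s hs S hS ↦ le_trans (Finset.sum_le_sum fun P hP ↦ ?_)
    (ht.sum_le_tsum S fun I _ ↦ by positivity)⟩
  have h2 : (2 : ℝ) ≤ Ideal.absNorm P := by exact_mod_cast two_le_absNorm_of_prime (hS P hP)
  rw [← Real.rpow_natCast, ← Real.rpow_mul (by linarith)]
  exact Real.rpow_le_rpow_of_exponent_le (by linarith) (by push_cast; linarith)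

/-- Every finite partial sum of the Dedekind zeta function is bounded by a finite Euler product. -/
lemma exists_sum_absNorm_rpow_le_exp {K : Type*} [Field K] [NumberField K] {s : ℝ} (hs : 1 < s)
    (A : Finset (Ideal (𝓞 K))) : ∃ S : Finset (Ideal (𝓞 K)), (∀ P ∈ S, Prime P) ∧
      ∑ I ∈ A, (Ideal.absNorm I : ℝ) ^ (-s) ≤ Real.exp (∑ P ∈ S, ((Ideal.absNorm P : ℝ) ^ (-s) +
        2 * ((Ideal.absNorm P : ℝ) ^ (-s)) ^ 2)) := by
  classical
  set B := A.filter (· ≠ ⊥)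
  set S := B.biUnion fun I ↦ (UniqueFactorizationMonoid.normalizedFactors I).toFinset
  have hS : ∀ P ∈ S, Prime P := by
    intro P hP
    obtain ⟨I, -, hI⟩ := Finset.mem_biUnion.1 hP
    exact UniqueFactorizationMonoid.prime_of_normalized_factor P (Multiset.mem_toFinset.1 hI)
  refine ⟨S, hS, ?_⟩
  have hAB : ∑ I ∈ A, (Ideal.absNorm I : ℝ) ^ (-s) = ∑ I ∈ B, (Ideal.absNorm I : ℝ) ^ (-s) := by
    refine (Finset.sum_subset (Finset.filter_subset _ _) fun I hI hIB ↦ ?_).symm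
    have : I = ⊥ := by
      by_contra h
      exact hIB (Finset.mem_filter.2 ⟨hI, h⟩)
    rw [this, Ideal.absNorm_bot, Nat.cast_zero, Real.zero_rpow (by linarith)]
  have hB : ∀ I ∈ B, I ≠ ⊥ := fun I hI ↦ (Finset.mem_filter.1 hI).2
  have hinj : Set.InjOn (UniqueFactorizationMonoid.normalizedFactors (α := Ideal (𝓞 K))) B := by
    intro I hI J hJ h
    rw [← Ideal.prod_normalizedFactors_eq_self (hB I hI), h,
      Ideal.prod_normalizedFactors_eq_self (hB J hJ)]
  rw [hAB, Finset.sum_congr rfl fun I hI ↦ absNorm_rpow_eq_prod_normalizedFactors (hB I hI) (-s),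
    ← Finset.sum_image (f := fun m : Multiset (Ideal (𝓞 K)) ↦
      (m.map fun P ↦ (Ideal.absNorm P : ℝ) ^ (-s)).prod) hinj]
  refine (sum_multiset_prod_le (fun P : Ideal (𝓞 K) ↦ (Ideal.absNorm P : ℝ) ^ (-s))
    (fun P ↦ by positivity) S (fun P hP ↦ ?_) _ fun m hm P hP ↦ ?_).trans ?_
  · linarith [absNorm_rpow_neg_le_half (hS P hP) hs.le]
  · obtain ⟨I, hI, rfl⟩ := Finset.mem_image.1 hm
    exact Finset.mem_biUnion.2 ⟨I, hI, Multiset.mem_toFinset.2 hP⟩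
  · rw [Real.exp_sum]
    refine Finset.prod_le_prod (fun P hP ↦ inv_nonneg.2 ?_) fun P hP ↦
      inv_one_sub_le_exp (absNorm_rpow_neg_le_half (hS P hP) hs.le)
    linarith [absNorm_rpow_neg_le_half (hS P hP) hs.le]

lemma exp_sum_absNorm_rpow_le_tsum {K : Type*} [Field K] [NumberField K] {s : ℝ}
    (h : Summable fun I : Ideal (𝓞 K) ↦ (Ideal.absNorm I : ℝ) ^ (-s))
    (T : Finset (Ideal (𝓞 K))) (hT : ∀ P ∈ T, Prime P) :
    Real.exp (∑ P ∈ T, ((Ideal.absNorm P : ℝ) ^ (-s) - ((Ideal.absNorm P : ℝ) ^ (-s)) ^ 2)) ≤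
      ∑' I : Ideal (𝓞 K), (Ideal.absNorm I : ℝ) ^ (-s) := by
  classical
  have hinj : Set.InjOn (fun U : Finset (Ideal (𝓞 K)) ↦ ∏ P ∈ U, P) T.powerset := by
    have key : ∀ U ⊆ T, ∀ V ⊆ T, ∏ P ∈ U, P = ∏ P ∈ V, P → U ⊆ V := by
      intro U hU V hV hUV P hP
      have h1 : P ∣ ∏ Q ∈ V, Q := hUV ▸ Finset.dvd_prod_of_mem _ hP
      obtain ⟨Q, hQ, hPQ⟩ := ((hT P (hU hP)).dvd_finsetProd_iff _).1 h1
      rwa [associated_iff_eq.1 ((hT P (hU hP)).associated_of_dvd (hT Q (hV hQ)) hPQ)]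
    intro U hU V hV hUV
    simp only [Finset.coe_powerset, Set.mem_preimage, Set.mem_powerset_iff, Finset.coe_subset]
      at hU hV
    exact (key U hU V hV hUV).antisymm (key V hV U hU hUV.symm)
  calc _ ≤ ∏ P ∈ T, (1 + (Ideal.absNorm P : ℝ) ^ (-s)) := by
        rw [Real.exp_sum]
        exact Finset.prod_le_prod (fun P _ ↦ (Real.exp_pos _).le) fun P _ ↦
          exp_sub_sq_le_one_add (by positivity)
    _ = ∑ U ∈ T.powerset, (Ideal.absNorm (∏ P ∈ U, P) : ℝ) ^ (-s) := by
        rw [Finset.prod_one_add]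
        refine Finset.sum_congr rfl fun U _ ↦ ?_
        rw [map_prod, Nat.cast_prod, Real.finsetProd_rpow _ _ fun P _ ↦ by positivity]
    _ ≤ _ := by
        rw [← Finset.sum_image (f := fun I : Ideal (𝓞 K) ↦ (Ideal.absNorm I : ℝ) ^ (-s)) hinj]
        exact h.sum_le_tsum _ fun I _ ↦ by positivity

/-- If all but finitely many primes of prime norm of `K` lie in `G`, then primes in `G` cannot
consistently give rise to `n ≥ 2` times as many primes of `L`. -/
theorem not_exists_primes_of_absNorm_sum_le (K L : Type*) [Field K] [NumberField K] [Field L]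
    [NumberField L] {n : ℕ} (hn : 2 ≤ n) (G : Set (Ideal (𝓞 K)))
    (hfin : {P : Ideal (𝓞 K) | Prime P ∧ (Ideal.absNorm P).Prime ∧ P ∉ G}.Finite)
    (hG : ∀ S : Finset (Ideal (𝓞 K)), (∀ P ∈ S, Prime P ∧ P ∈ G) →
      ∃ T : Finset (Ideal (𝓞 L)), (∀ Q ∈ T, Prime Q) ∧ ∀ s : ℝ, 1 < s →
        n * ∑ P ∈ S, (Ideal.absNorm P : ℝ) ^ (-s) ≤ ∑ Q ∈ T, (Ideal.absNorm Q : ℝ) ^ (-s)) :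
    False := by
  classical
  obtain ⟨C₁, hC₁⟩ := exists_sum_inv_absNorm_le K
  obtain ⟨C₂, hC₂⟩ := exists_sum_sq_absNorm_rpow_le K
  obtain ⟨C₃, hC₃⟩ := exists_sum_sq_absNorm_rpow_le L
  have hn0 : (0 : ℝ) < n := by exact_mod_cast (by omega : 0 < n)
  set F := hfin.toFinset
  set C := C₁ + F.card + 2 * C₂
  have hbound : ∀ᶠ s : ℝ in 𝓝[>] 1, (∑' I : Ideal (𝓞 K), (Ideal.absNorm I : ℝ) ^ (-s)) ^ n ≤
      Real.exp (n * C + C₃) * ∑' I : Ideal (𝓞 L), (Ideal.absNorm I : ℝ) ^ (-s) := by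
    filter_upwards [eventually_summable_absNorm_rpow K, eventually_summable_absNorm_rpow L,
      self_mem_nhdsWithin] with s hK hL hs
    have hs1 : 1 < s := hs
    set ZL := ∑' I : Ideal (𝓞 L), (Ideal.absNorm I : ℝ) ^ (-s)
    have hZL : 0 < ZL :=
      lt_of_lt_of_le (Real.exp_pos _) (exp_sum_absNorm_rpow_le_tsum hL.1 ∅ (by simp))
    have hpart : ∀ A : Finset (Ideal (𝓞 K)), ∑ I ∈ A, (Ideal.absNorm I : ℝ) ^ (-s) ≤
        Real.exp (C + (C₃ + Real.log ZL) / n) := by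
      intro A
      obtain ⟨S, hS, hAS⟩ := exists_sum_absNorm_rpow_le_exp hs1 A
      refine hAS.trans (Real.exp_le_exp.2 ?_)
      have hle1 : ∀ P ∈ S, (Ideal.absNorm P : ℝ) ^ (-s) ≤ (Ideal.absNorm P : ℝ)⁻¹ := by
        intro P hP
        have : (2 : ℝ) ≤ Ideal.absNorm P := by exact_mod_cast two_le_absNorm_of_prime (hS P hP)
        rw [← Real.rpow_neg_one]
        exact Real.rpow_le_rpow_of_exponent_le (by linarith) (by linarith)
      have hgood : ∑ P ∈ S with P ∈ G, (Ideal.absNorm P : ℝ) ^ (-s) ≤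
          (C₃ + Real.log ZL) / n := by
        obtain ⟨T, hT, hle⟩ := hG (S.filter (· ∈ G)) fun P hP ↦
          ⟨hS P (Finset.mem_filter.1 hP).1, (Finset.mem_filter.1 hP).2⟩
        have h1 := (Real.le_log_iff_exp_le hZL).2 (exp_sum_absNorm_rpow_le_tsum hL.1 T hT)
        rw [Finset.sum_sub_distrib] at h1
        rw [le_div_iff₀ hn0]
        linarith [hle s hs1, hC₃ s hs1 T hT]
      have hbad : ∑ P ∈ S with P ∉ G, (Ideal.absNorm P : ℝ) ^ (-s) ≤ C₁ + F.card := by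
        rw [← Finset.sum_filter_not_add_sum_filter _ (fun P ↦ (Ideal.absNorm P).Prime)]
        refine add_le_add ?_ ?_
        · refine (Finset.sum_le_sum fun P hP ↦ hle1 P ?_).trans (hC₁ _ fun P hP ↦ ⟨hS P ?_, ?_⟩)
          all_goals simp only [Finset.mem_filter] at hP
          exacts [hP.1.1, hP.1.1, hP.2]
        · have hsub : ((S.filter (· ∉ G)).filter fun P ↦ (Ideal.absNorm P).Prime) ⊆ F := by
            intro P hP
            simp only [Finset.mem_filter] at hP
            exact hfin.mem_toFinset.2 ⟨hS P hP.1.1, hP.2, hP.1.2⟩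
          refine le_trans ?_ (Nat.cast_le.2 (Finset.card_le_card hsub))
          rw [Finset.card_eq_sum_ones, Nat.cast_sum]
          refine Finset.sum_le_sum fun P hP ↦ ?_
          simp only [Finset.mem_filter] at hP
          push_cast
          linarith [absNorm_rpow_neg_le_half (hS P hP.1.1) hs1.le]
      rw [Finset.sum_add_distrib, ← Finset.mul_sum,
        ← Finset.sum_filter_add_sum_filter_not S (· ∈ G)]
      linarith [hC₂ s hs1 S hS]
    have hZK := hK.1.tsum_le_of_sum_le hpart
    refine (pow_le_pow_left₀ (tsum_nonneg fun I ↦ by positivity) hZK n).trans (le_of_eq ?_)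
    rw [← Real.exp_nat_mul, mul_add, mul_div_cancel₀ _ hn0.ne', ← add_assoc, Real.exp_add _ (Real.log ZL),
      Real.exp_log hZL]
  have hlimK := (tendsto_sub_one_mul_tsum_absNorm_rpow K).pow n
  have hlimL : Tendsto (fun s : ℝ ↦ Real.exp (n * C + C₃) * ((s - 1) ^ (n - 1) * ((s - 1) *
      ∑' I : Ideal (𝓞 L), (Ideal.absNorm I : ℝ) ^ (-s)))) (𝓝[>] 1)
      (𝓝 (Real.exp (n * C + C₃) * (0 ^ (n - 1) * dedekindZeta_residue L))) := by
    refine tendsto_const_nhds.mul (Tendsto.mul ?_ (tendsto_sub_one_mul_tsum_absNorm_rpow L))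
    refine Tendsto.pow ?_ _
    have : Tendsto (fun s : ℝ ↦ s - 1) (𝓝 1) (𝓝 0) := by
      simpa using (tendsto_id (x := 𝓝 (1 : ℝ))).sub_const 1
    exact this.mono_left nhdsWithin_le_nhds
  rw [zero_pow (by omega), zero_mul, mul_zero] at hlimL
  refine absurd (le_of_tendsto_of_tendsto hlimK hlimL ?_)
    (not_le.2 (pow_pos (dedekindZeta_residue_pos K) n))
  filter_upwards [hbound, self_mem_nhdsWithin] with s hs hs1
  have hs0 : 0 ≤ s - 1 := sub_nonneg.2 (le_of_lt hs1)
  rw [mul_pow]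
  calc _ ≤ (s - 1) ^ n * (Real.exp (n * C + C₃) *
        ∑' I : Ideal (𝓞 L), (Ideal.absNorm I : ℝ) ^ (-s)) :=
        mul_le_mul_of_nonneg_left hs (pow_nonneg hs0 n)
    _ = _ := by
        obtain ⟨m, rfl⟩ : ∃ m, n = m + 1 := ⟨n - 1, by omega⟩
        rw [Nat.add_sub_cancel, pow_succ]
        ring

lemma Ideal.finite_setOf_mem {K : Type*} [Field K] [NumberField K] {a : 𝓞 K} (ha : a ≠ 0) :
    {P : Ideal (𝓞 K) | a ∈ P}.Finite := by
  refine (Ideal.finite_setOfPred_absNorm_le (S := 𝓞 K) (Ideal.absNorm (Ideal.span {a}))).subset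
    fun P hP ↦ Nat.le_of_dvd (Nat.pos_of_ne_zero ?_)
      (Ideal.absNorm_dvd_absNorm_of_le ((Ideal.span_singleton_le_iff_mem _).2 hP))
  rw [Ne, Ideal.absNorm_eq_zero_iff, Ideal.span_singleton_eq_bot]
  exact ha

lemma eq_one_of_sub_one_mem {R : Type*} [CommRing R] [IsDomain R] {n : ℕ} {Q : Ideal R}
    (hn : (n : R) ∉ Q) {η : R} (hη : η ^ n = 1) (h : η - 1 ∈ Q) : η = 1 := by
  by_contra hne
  refine hn ?_
  have h0 : ∑ i ∈ range n, η ^ i = 0 := by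
    have := geom_sum_mul η n
    rw [hη, sub_self] at this
    exact (mul_eq_zero.1 this).resolve_right (sub_ne_zero.2 hne)
  rw [← Ideal.Quotient.eq_zero_iff_mem] at h ⊢
  rw [map_sub, map_one, sub_eq_zero] at h
  have h1 := congrArg (Ideal.Quotient.mk Q) h0
  simpa [map_sum, map_pow, h] using h1

lemma exists_sub_algebraMap_mem {R S : Type*} [CommRing R] [CommRing S] [IsDomain S] [Algebra R S]
    [FaithfulSMul R S] {q : ℕ} (hq : 0 < q) {ζ : R} (hζ : IsPrimitiveRoot ζ q) {a c : R} {α : S}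
    (hα : α ^ q = algebraMap R S a) {Q : Ideal S} (hQ : Q.IsPrime)
    (hc : algebraMap R S (a - c ^ q) ∈ Q) : ∃ d : R, α - algebraMap R S d ∈ Q := by
  have : NeZero q := ⟨hq.ne'⟩
  have hζ' := hζ.map_of_injective (FaithfulSMul.algebraMap_injective R S)
  rw [map_sub, map_pow, ← hα, hζ'.pow_sub_pow_eq_prod_sub_mul _ _ hq, hQ.prod_mem_iff] at hc
  obtain ⟨η, hη, h⟩ := hc
  rw [Polynomial.mem_nthRootsFinset hq] at hη
  obtain ⟨i, -, rfl⟩ := hζ'.eq_pow_of_pow_eq_one hη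
  exact ⟨ζ ^ i * c, by rwa [map_mul, map_pow]⟩

section Kummer

variable {K L : Type*} [Field K] [NumberField K] [Field L] [NumberField L] [Algebra K L]
  {q : ℕ} {ζ : 𝓞 K} {α : 𝓞 L}

lemma absNorm_le_of_forall_pow_sub_mem {Q : Ideal (𝓞 L)} (hQ : Q.IsPrime) (hQ0 : Q ≠ ⊥) {p : ℕ}
    (hp : 1 < p) (h : ∀ x : 𝓞 L, x - x ^ p ∈ Q) : Ideal.absNorm Q ≤ p := by
  have hmax : Q.IsMaximal := hQ.isMaximal hQ0
  let _ := Ideal.Quotient.field Q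
  have : Finite (𝓞 L ⧸ Q) := Ideal.finiteQuotientOfFreeOfNeBot Q hQ0
  have := Fintype.ofFinite (𝓞 L ⧸ Q)
  have h1 : ∀ x : (𝓞 L ⧸ Q)ˣ, x ^ (p - 1) = 1 := by
    intro x
    obtain ⟨y, hy⟩ := Ideal.Quotient.mk_surjective (x : 𝓞 L ⧸ Q)
    have h2 := h y
    rw [← Ideal.Quotient.eq_zero_iff_mem, map_sub, map_pow, hy, sub_eq_zero] at h2
    have h3 : x ^ (p - 1) * x = 1 * x := by
      rw [← pow_succ, Nat.sub_add_cancel hp.le, one_mul]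
      exact Units.ext (by rw [Units.val_pow_eq_pow_val, ← h2])
    exact mul_right_cancel h3
  have h4 := Nat.le_of_dvd (by omega) ((FiniteField.forall_pow_eq_one_iff (𝓞 L ⧸ Q) (p - 1)).1 h1)
  rw [Ideal.absNorm_apply, Submodule.cardQuot_apply, Nat.card_eq_fintype_card]
  omega

variable [IsGalois K L]

lemma eq_one_of_smul_sub_mem (hq : q.Prime) (hζ : IsPrimitiveRoot ζ q) {a : 𝓞 K}
    (hα : α ^ q = algebraMap (𝓞 K) (𝓞 L) a)
    (hgen : ∀ σ : Gal(L/K), σ • α = α → σ = 1) {Q : Ideal (𝓞 L)} [Q.IsPrime]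
    (hqQ : (q : 𝓞 L) ∉ Q) (hαQ : α ∉ Q) {σ : Gal(L/K)} (hσ : σ • α - α ∈ Q) : σ = 1 := by
  have : NeZero q := ⟨hq.ne_zero⟩
  have hinj := FaithfulSMul.algebraMap_injective (𝓞 K) (𝓞 L)
  have hζ' := hζ.map_of_injective hinj
  have h1 : (σ • α) ^ q = α ^ q := by
    rw [← smul_pow', hα, smul_algebraMap]
  have h2 := hζ'.pow_sub_pow_eq_prod_sub_mul (σ • α) α hq.pos
  rw [h1, sub_self, eq_comm, Finset.prod_eq_zero_iff] at h2
  obtain ⟨η, hη, h3⟩ := h2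
  rw [Polynomial.mem_nthRootsFinset hq.pos] at hη
  rw [sub_eq_zero] at h3
  have h4 : (η - 1) * α ∈ Q := by rwa [sub_mul, one_mul, ← h3]
  have h5 := eq_one_of_sub_one_mem hqQ hη ((‹Q.IsPrime›.mem_or_mem h4).resolve_right hαQ)
  exact hgen σ (by rw [h3, h5, one_mul])

/-- In a Kummer extension `L = K(a^(1/q))`, the primes above `P` have the same norm as `P` when `a`
is a nonzero `q`-th power modulo `P`. -/
lemma absNorm_le_of_liesOver (hq : q.Prime) (hζ : IsPrimitiveRoot ζ q) {a c : 𝓞 K}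
    (hα : α ^ q = algebraMap (𝓞 K) (𝓞 L) a)
    (hgen : ∀ σ : Gal(L/K), σ • α = α → σ = 1) {P : Ideal (𝓞 K)} (hP : Prime P)
    (hqP : (q : 𝓞 K) ∉ P) (haP : a ∉ P) (hc : a - c ^ q ∈ P) {Q : Ideal (𝓞 L)}
    (hQ : Q.IsPrime) (hQP : Q.LiesOver P) : Ideal.absNorm Q ≤ Ideal.absNorm P := by
  have hmem : ∀ x : 𝓞 K, algebraMap (𝓞 K) (𝓞 L) x ∈ Q ↔ x ∈ P := fun x ↦
    (Ideal.mem_of_liesOver Q P x).symm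
  have hP' : P.IsPrime := Ideal.isPrime_of_prime hP
  have hQ0 : Q ≠ ⊥ := by
    have := Ideal.ne_bot_of_liesOver_of_ne_bot hP.ne_zero Q
    exact this
  have : Finite (𝓞 L ⧸ Q) := Ideal.finiteQuotientOfFreeOfNeBot Q hQ0
  have hqQ : (q : 𝓞 L) ∉ Q := by
    rwa [← map_natCast (algebraMap (𝓞 K) (𝓞 L)), hmem]
  have hαQ : α ∉ Q := fun h ↦ haP ((hmem a).1 (hα ▸ Q.pow_mem_of_mem h q hq.pos))
  obtain ⟨σ, hσ⟩ := IsArithFrobAt.exists_of_isInvariant (𝓞 K) Gal(L/K) Q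
  have hcard : Nat.card (𝓞 K ⧸ Q.under (𝓞 K)) = Ideal.absNorm P := by
    rw [← Q.over_def P, Ideal.absNorm_apply, Submodule.cardQuot_apply]
  have hfrob : ∀ x : 𝓞 L, σ • x - x ^ Ideal.absNorm P ∈ Q := fun x ↦ hcard ▸ hσ x
  have hfermat : ∀ d : 𝓞 K, d ^ Ideal.absNorm P - d ∈ P := by
    intro d
    have hmax : P.IsMaximal := hP'.isMaximal hP.ne_zero
    let _ := Ideal.Quotient.field P
    have : Finite (𝓞 K ⧸ P) := Ideal.finiteQuotientOfFreeOfNeBot P hP.ne_zero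
    have := Fintype.ofFinite (𝓞 K ⧸ P)
    rw [← Ideal.Quotient.eq_zero_iff_mem, map_sub, map_pow, sub_eq_zero, Ideal.absNorm_apply,
      Submodule.cardQuot_apply, Nat.card_eq_fintype_card, FiniteField.pow_card]
  obtain ⟨d, hd⟩ := exists_sub_algebraMap_mem hq.pos hζ hα hQ ((hmem _).2 hc)
  have hσ1 : σ = 1 := by
    refine eq_one_of_smul_sub_mem hq hζ hα hgen hqQ hαQ ?_
    have h1 := hfrob α
    have h2 := (hmem _).2 (hfermat d)
    rw [← Ideal.Quotient.eq_zero_iff_mem] at h1 h2 hd ⊢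
    simp only [map_sub, map_pow, sub_eq_zero] at h1 h2 hd ⊢
    rw [h1, hd, h2]
  refine absNorm_le_of_forall_pow_sub_mem hQ hQ0 (two_le_absNorm_of_prime hP) fun x ↦ ?_
  simpa [hσ1] using hfrob x

open scoped Pointwise in
lemma exists_primes_liesOver (hq : q.Prime) (hζ : IsPrimitiveRoot ζ q) {a c : 𝓞 K}
    (hα : α ^ q = algebraMap (𝓞 K) (𝓞 L) a)
    (hgen : ∀ σ : Gal(L/K), σ • α = α → σ = 1) {P : Ideal (𝓞 K)} (hP : Prime P)
    (hqP : (q : 𝓞 K) ∉ P) (haP : a ∉ P) (hc : a - c ^ q ∈ P) :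
    ∃ T : Finset (Ideal (𝓞 L)), T.card = Module.finrank K L ∧
      ∀ Q ∈ T, Prime Q ∧ Q.under (𝓞 K) = P ∧ Ideal.absNorm Q ≤ Ideal.absNorm P := by
  classical
  have hP' : P.IsPrime := Ideal.isPrime_of_prime hP
  have hmax : P.IsMaximal := hP'.isMaximal hP.ne_zero
  obtain ⟨Q, hQmax, hQP⟩ := Ideal.exists_maximal_ideal_liesOver_of_isIntegral (S := 𝓞 L) P
  have hmem : ∀ x : 𝓞 K, algebraMap (𝓞 K) (𝓞 L) x ∈ Q ↔ x ∈ P := fun x ↦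
    (Ideal.mem_of_liesOver Q P x).symm
  have hqQ : (q : 𝓞 L) ∉ Q := by
    rwa [← map_natCast (algebraMap (𝓞 K) (𝓞 L)), hmem]
  have hαQ : α ∉ Q := fun h ↦ haP ((hmem a).1 (hα ▸ Q.pow_mem_of_mem h q hq.pos))
  obtain ⟨d, hd⟩ := exists_sub_algebraMap_mem hq.pos hζ hα hQmax.isPrime ((hmem _).2 hc)
  have hstab : ∀ σ : Gal(L/K), σ • Q = Q → σ = 1 := by
    intro σ hσ
    refine eq_one_of_smul_sub_mem hq hζ hα hgen hqQ hαQ ?_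
    have h1 : σ • (α - algebraMap (𝓞 K) (𝓞 L) d) ∈ Q := by
      rw [← hσ, Ideal.smul_mem_pointwise_smul_iff]
      exact hd
    rw [smul_sub, smul_algebraMap] at h1
    simpa using sub_mem h1 hd
  have hinj : Function.Injective fun σ : Gal(L/K) ↦ σ • Q := by
    intro σ τ h
    have := hstab (τ⁻¹ * σ) (by rw [mul_smul, show σ • Q = τ • Q from h, inv_smul_smul])
    rwa [inv_mul_eq_one, eq_comm] at this
  refine ⟨Finset.univ.image fun σ : Gal(L/K) ↦ σ • Q, ?_, ?_⟩
  · rw [Finset.card_image_of_injective _ hinj, Finset.card_univ, ← Nat.card_eq_fintype_card,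
      IsGalois.card_aut_eq_finrank]
  · intro Q' hQ'
    obtain ⟨σ, -, rfl⟩ := Finset.mem_image.1 hQ'
    have hlo : (σ • Q).LiesOver P := inferInstance
    have hprime : (σ • Q).IsPrime := inferInstance
    exact ⟨Ideal.prime_of_isPrime (Ideal.ne_bot_of_liesOver_of_ne_bot hP.ne_zero _) hprime,
      (Ideal.over_def _ P).symm, absNorm_le_of_liesOver hq hζ hα hgen hP hqP haP hc hprime hlo⟩

end Kummer

universe u

lemma exists_kummer_extension {K : Type u} [Field K] [NumberField K] {q : ℕ} (hq : q.Prime)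
    {ζ : K} (hζ : IsPrimitiveRoot ζ q) {a : K} (ha : ∀ b : K, b ^ q ≠ a) :
    ∃ (L : Type u) (_ : Field L) (_ : NumberField L) (_ : Algebra K L) (_ : IsGalois K L) (α : L),
      Module.finrank K L = q ∧ α ^ q = algebraMap K L a ∧
        ∀ σ : Gal(L/K), σ α = α → σ = 1 := by
  have hζ' : (primitiveRoots q K).Nonempty := ⟨ζ, (mem_primitiveRoots hq.pos).2 hζ⟩
  have H : Irreducible (Polynomial.X ^ q - Polynomial.C a) :=
    X_pow_sub_C_irreducible_of_prime hq ha
  have := Fact.mk H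
  have hs := isSplittingField_AdjoinRoot_X_pow_sub_C hζ' H
  have hg := isGalois_of_isSplittingField_X_pow_sub_C hζ' H
    (AdjoinRoot (Polynomial.X ^ q - Polynomial.C a))
  have hfr := finrank_of_isSplittingField_X_pow_sub_C hζ' H
    (AdjoinRoot (Polynomial.X ^ q - Polynomial.C a))
  have hfd : FiniteDimensional K (AdjoinRoot (Polynomial.X ^ q - Polynomial.C a)) :=
    .of_finrank_pos (by rw [hfr]; exact hq.pos)
  have hchar : CharZero (AdjoinRoot (Polynomial.X ^ q - Polynomial.C a)) :=
    charZero_of_injective_algebraMap (algebraMap K _).injective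
  have hnf : NumberField (AdjoinRoot (Polynomial.X ^ q - Polynomial.C a)) :=
    { to_charZero := hchar
      to_finiteDimensional := .trans ℚ K _ }
  refine ⟨AdjoinRoot (Polynomial.X ^ q - Polynomial.C a), inferInstance, hnf, inferInstance, hg,
    AdjoinRoot.root _, hfr, root_X_pow_sub_C_pow q a, fun σ hσ ↦ ?_⟩
  have h : σ.toAlgHom = AlgHom.id K _ := AdjoinRoot.algHom_ext hσ
  exact AlgEquiv.ext fun x ↦ DFunLike.congr_fun h x

lemma exists_eq_pow_mul_pow_of_kummer {K L : Type*} [Field K] [Field L] [Algebra K L]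
    [FiniteDimensional K L] [IsGalois K L] {q : ℕ} (hq : q.Prime) {ζ : K}
    (hζ : IsPrimitiveRoot ζ q) {a : K} (ha : a ≠ 0) {α : L} (hfr : Module.finrank K L = q)
    (hα : α ^ q = algebraMap K L a) (hgen : ∀ σ : Gal(L/K), σ α = α → σ = 1)
    {x : K} {c : L} (hc : c ^ q = algebraMap K L x) :
    ∃ (i : ℕ) (d : K), x = a ^ i * d ^ q := by
  have : NeZero q := ⟨hq.ne_zero⟩
  have : Fact q.Prime := ⟨hq⟩
  have hcard : Nat.card Gal(L/K) = q := (IsGalois.card_aut_eq_finrank K L).trans hfr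
  have hζ' := hζ.map_of_injective (algebraMap K L).injective
  have hα0 : α ≠ 0 := by
    rintro rfl
    rw [zero_pow hq.ne_zero, eq_comm, map_eq_zero] at hα
    exact ha hα
  have hroot : ∀ (σ : Gal(L/K)) {y : L} {b : K}, y ^ q = algebraMap K L b → y ≠ 0 →
      ∃ η : K, η ^ q = 1 ∧ σ y = algebraMap K L η * y := by
    intro σ y b hy hy0
    have h1 : (σ y / y) ^ q = 1 := by
      rw [div_pow, ← map_pow, hy, AlgEquiv.commutes, ← hy, div_self (pow_ne_zero _ hy0)]
    obtain ⟨i, -, hi⟩ := hζ'.eq_pow_of_pow_eq_one h1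
    refine ⟨ζ ^ i, by rw [← pow_mul, mul_comm, pow_mul, hζ.pow_eq_one, one_pow], ?_⟩
    rw [map_pow, hi, div_mul_cancel₀ _ hy0]
  have : Nontrivial Gal(L/K) := Finite.one_lt_card_iff_nontrivial.1 (hcard ▸ hq.one_lt)
  obtain ⟨σ, hσ⟩ := exists_ne (1 : Gal(L/K))
  obtain ⟨η, hη, hση⟩ := hroot σ hα hα0
  have hη1 : η ≠ 1 := by
    rintro rfl
    exact hσ (hgen σ (by rw [hση, map_one, one_mul]))
  have hηp : IsPrimitiveRoot η q := by
    have := orderOf_eq_prime hη hη1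
    rw [← this]
    exact IsPrimitiveRoot.orderOf η
  obtain rfl | hc0 := eq_or_ne c 0
  · rw [zero_pow hq.ne_zero, eq_comm, map_eq_zero] at hc
    exact ⟨0, 0, by rw [hc, zero_pow hq.ne_zero, mul_zero]⟩
  obtain ⟨η', hη', hσc⟩ := hroot σ hc hc0
  obtain ⟨i, -, rfl⟩ := hηp.eq_pow_of_pow_eq_one hη'
  have hfix : σ (c / α ^ i) = c / α ^ i := by
    have h0 : algebraMap K L η ≠ 0 := by
      rw [Ne, map_eq_zero]
      exact hηp.ne_zero hq.ne_zero
    rw [map_div₀, map_pow, hσc, hση, mul_pow, map_pow, mul_div_mul_left _ _ (pow_ne_zero _ h0)]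
  have hall : ∀ τ : Gal(L/K), τ (c / α ^ i) = c / α ^ i := by
    intro τ
    have hτ : τ ∈ MulAction.stabilizer Gal(L/K) (c / α ^ i) := by
      have := (Subgroup.zpowers_le (H := MulAction.stabilizer Gal(L/K) (c / α ^ i))).2 hfix
      exact this (mem_zpowers_of_prime_card hcard hσ)
    exact hτ
  obtain ⟨d, hd⟩ := (IsGalois.mem_bot_iff_fixed _).2 hall
  refine ⟨i, d, (algebraMap K L).injective ?_⟩
  have hd' : algebraMap K L d = c / α ^ i := hd
  rw [map_mul, map_pow, map_pow, hd', ← hc, ← hα, ← pow_mul, mul_comm q, pow_mul, ← mul_pow,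
    mul_div_cancel₀ _ (pow_ne_zero _ hα0)]

/-- In a number field containing the `q`-th roots of unity, an integer that is not a `q`-th power is
not a `q`-th power modulo infinitely many primes of degree one. -/
theorem infinite_setOf_forall_sub_pow_notMem {K : Type u} [Field K] [NumberField K] {q : ℕ}
    (hq : q.Prime) {ζ : K} (hζ : IsPrimitiveRoot ζ q) {a : 𝓞 K} (ha : ∀ b : K, b ^ q ≠ a) :
    {P : Ideal (𝓞 K) | Prime P ∧ (Ideal.absNorm P).Prime ∧ ∀ c : 𝓞 K, a - c ^ q ∉ P}.Infinite := by
  classical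
  intro hfin
  have : NeZero q := ⟨hq.ne_zero⟩
  obtain ⟨L, _, _, _, _, α, hfr, hα, hgen⟩ := exists_kummer_extension hq hζ ha
  have hαint : IsIntegral ℤ α := by
    refine .of_pow hq.pos ?_
    rw [hα]
    exact (RingOfIntegers.isIntegral_coe a).algebraMap
  let β : 𝓞 L := ⟨α, hαint⟩
  have hβ : β ^ q = algebraMap (𝓞 K) (𝓞 L) a := RingOfIntegers.ext hα
  have hgenβ : ∀ σ : Gal(L/K), σ • β = β → σ = 1 := fun σ hσ ↦
    hgen σ (congrArg (algebraMap (𝓞 L) L) hσ)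
  have ha0 : a ≠ 0 := by
    rintro rfl
    exact ha 0 (zero_pow hq.ne_zero)
  have hq0 : (q : 𝓞 K) ≠ 0 := Nat.cast_ne_zero.2 hq.ne_zero
  refine not_exists_primes_of_absNorm_sum_le K L hq.two_le
    {P | (∃ c : 𝓞 K, a - c ^ q ∈ P) ∧ a ∉ P ∧ (q : 𝓞 K) ∉ P} ?_ fun S hS ↦ ?_
  · refine ((hfin.union (Ideal.finite_setOf_mem ha0)).union (Ideal.finite_setOf_mem hq0)).subset ?_
    rintro P ⟨hP, hPn, hPG⟩
    by_contra hcon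
    simp only [Set.mem_union, Set.mem_ofPred_eq, not_or, not_and, not_forall, not_not] at hcon
    exact hPG ⟨hcon.1.1 hP hPn, hcon.1.2, hcon.2⟩
  · have hex : ∀ P : Ideal (𝓞 K), ∃ T : Finset (Ideal (𝓞 L)), P ∈ S → T.card = q ∧
        ∀ Q ∈ T, Prime Q ∧ Q.under (𝓞 K) = P ∧ Ideal.absNorm Q ≤ Ideal.absNorm P := by
      intro P
      by_cases hPS : P ∈ S
      · obtain ⟨hP, ⟨c, hc⟩, haP, hqP⟩ := hS P hPS
        obtain ⟨T, hT, h⟩ := exists_primes_liesOver hq hζ.toInteger_isPrimitiveRoot hβ hgenβ hP hqP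
          haP hc
        exact ⟨T, fun _ ↦ ⟨hT.trans hfr, h⟩⟩
      · exact ⟨∅, fun h ↦ absurd h hPS⟩
    choose T hT using hex
    refine ⟨S.biUnion T, fun Q hQ ↦ ?_, fun s hs ↦ ?_⟩
    · obtain ⟨P, hP, hQP⟩ := Finset.mem_biUnion.1 hQ
      exact ((hT P hP).2 Q hQP).1
    rw [Finset.sum_biUnion, Finset.mul_sum]
    · refine Finset.sum_le_sum fun P hP ↦ ?_
      rw [← (hT P hP).1, ← nsmul_eq_mul]
      refine Finset.card_nsmul_le_sum _ _ _ fun Q hQ ↦ ?_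
      obtain ⟨hQp, -, hle⟩ := (hT P hP).2 Q hQ
      refine Real.rpow_le_rpow_of_nonpos ?_ (by exact_mod_cast hle) (by linarith)
      exact_mod_cast (two_le_absNorm_of_prime hQp).trans_lt' two_pos
    · intro P hP P' hP' hne
      refine Finset.disjoint_left.2 fun Q hQ hQ' ↦ hne ?_
      rw [← ((hT P hP).2 Q hQ).2.1, ← ((hT P' hP').2 Q hQ').2.1]

/-- Adjoining `q`-th roots of the `b i` does not make `a` into a `q`-th power, if `a` is independent
of the `b i` modulo `q`-th powers. -/
theorem exists_extension_forall_eq_pow {q : ℕ} (hq : q.Prime) (n : ℕ) :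
    ∀ (K : Type u) [Field K] [NumberField K] (ζ : K), IsPrimitiveRoot ζ q →
      ∀ (b : Fin n → K) (a : K), (∀ i, b i ≠ 0) →
      (∀ (e : Fin n → ℕ) (c : K), c ^ q ≠ a * ∏ i, b i ^ e i) →
      ∃ (L : Type u) (_ : Field L) (_ : NumberField L) (_ : Algebra K L),
        (∀ i, ∃ c : L, c ^ q = algebraMap K L (b i)) ∧ ∀ c : L, c ^ q ≠ algebraMap K L a := by
  induction n with
  | zero =>
    intro K _ _ ζ _ b a _ h
    exact ⟨K, inferInstance, inferInstance, inferInstance, fun i ↦ i.elim0,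
      fun c ↦ by simpa using h (fun _ ↦ 0) c⟩
  | succ n ih =>
    intro K _ _ ζ hζ b a hb h
    by_cases h0 : ∃ c : K, c ^ q = b 0
    · obtain ⟨L, _, _, _, h1, h2⟩ := ih K ζ hζ (fun i ↦ b i.succ) a (fun i ↦ hb _) fun e c hc ↦ by
        refine h (Fin.cons 0 e) c ?_
        simpa [Fin.prod_univ_succ] using hc
      refine ⟨L, inferInstance, inferInstance, inferInstance, Fin.cases ?_ h1, h2⟩
      obtain ⟨c, hc⟩ := h0
      exact ⟨algebraMap K L c, by rw [← map_pow, hc]⟩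
    · push Not at h0
      obtain ⟨M, _, _, _, _, α, hfr, hα, hgen⟩ := exists_kummer_extension hq hζ h0
      obtain ⟨L, _, _, _, h1, h2⟩ := ih M (algebraMap K M ζ)
        (hζ.map_of_injective (algebraMap K M).injective) (fun i ↦ algebraMap K M (b i.succ))
        (algebraMap K M a) (fun i ↦ by simpa using hb _) fun e c hc ↦ by
          simp only [← map_pow, ← map_prod, ← map_mul] at hc
          obtain ⟨i, d, hd⟩ := exists_eq_pow_mul_pow_of_kummer hq hζ (hb 0) hfr hα hgen hc
          refine h (Fin.cons ((q - 1) * i) e) (b 0 ^ i * d) ?_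
          rw [Fin.prod_univ_succ]
          simp only [Fin.cons_zero, Fin.cons_succ]
          rw [mul_left_comm, hd, ← mul_assoc, ← pow_add, mul_pow, ← pow_mul, ← add_one_mul,
            Nat.sub_add_cancel hq.one_le, mul_comm q]
      let _ : Algebra K L := ((algebraMap M L).comp (algebraMap K M)).toAlgebra
      refine ⟨L, inferInstance, inferInstance, inferInstance, Fin.cases ?_ h1, h2⟩
      exact ⟨algebraMap M L α, by rw [← map_pow, hα]; rfl⟩

lemma exists_numberField_isCyclotomicExtension (n : ℕ) [NeZero n] :
    ∃ (K : Type) (_ : Field K) (_ : NumberField K), IsCyclotomicExtension {n} ℚ K := by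
  refine ⟨CyclotomicField n ℚ, inferInstance, inferInstance, ?_⟩
  have h := CyclotomicField.isCyclotomicExtension n ℚ
  rwa [Subsingleton.elim (CyclotomicField.algebra n ℚ) DivisionRing.toRatAlgebra] at h

lemma dvd_factorization_of_eq_pow {K : Type*} [Field K] [NumberField K] {q : ℕ}
    [IsCyclotomicExtension {q} ℚ K] (hq : q.Prime) {N : ℕ} (hN : N ≠ 0) {c : K} (hc : c ^ q = N)
    {p : ℕ} (hp : p.Prime) :
    q ∣ N.factorization p := by
  have : NeZero q := ⟨hq.ne_zero⟩
  have : Fact p.Prime := ⟨hp⟩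
  have hdeg : Module.finrank ℚ (K) = q - 1 := by
    rw [IsCyclotomicExtension.finrank (n := q) _
      (Polynomial.cyclotomic.irreducible_rat hq.pos), Nat.totient_prime hq]
  have h1 : (Algebra.norm ℚ c) ^ q = (N : ℚ) ^ (q - 1) := by
    rw [← map_pow, hc, ← map_natCast (algebraMap ℚ (K)), Algebra.norm_algebraMap,
      hdeg]
  have hN' : (N : ℚ) ≠ 0 := Nat.cast_ne_zero.2 hN
  have h0 : Algebra.norm ℚ c ≠ 0 := by
    intro h
    rw [h, zero_pow hq.ne_zero, eq_comm] at h1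
    exact pow_ne_zero _ hN' h1
  have h2 := congrArg (padicValRat p) h1
  rw [padicValRat.pow, padicValRat.pow, padicValRat.of_nat] at h2
  have h3 : q ∣ (q - 1) * padicValNat p N := by
    rw [← Int.natCast_dvd_natCast, Nat.cast_mul, ← h2]
    exact dvd_mul_right _ _
  rw [Nat.factorization_def _ hp]
  refine (Nat.Coprime.dvd_of_dvd_mul_left ?_ h3)
  rw [hq.coprime_iff_not_dvd]
  exact fun h ↦ absurd (Nat.le_of_dvd (by have := hq.two_le; omega) h)
    (by have := hq.two_le; omega)

lemma factorization_prod_prime_pow {ι : Type*} [Fintype ι] {p : ι → ℕ} (hp : ∀ i, (p i).Prime)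
    (hpinj : Function.Injective p) (e : ι → ℕ) (j : ι) :
    (∏ i, p i ^ e i).factorization (p j) = e j := by
  rw [Nat.factorization_prod fun i _ ↦ pow_ne_zero _ (hp i).ne_zero, Finsupp.finsetSum_apply,
    Finset.sum_eq_single j]
  · rw [(hp j).factorization_pow, Finsupp.single_eq_same]
  · intro i _ hij
    rw [(hp i).factorization_pow, Finsupp.single_eq_of_ne]
    exact fun h ↦ hij (hpinj h.symm)
  · exact fun h ↦ absurd (mem_univ j) h

lemma exists_pow_eq_of_pow_eq_pow {F : Type*} [Field F] {q M : ℕ} (hq : q.Prime) (hM : ¬ q ∣ M)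
    {x d : F} (hx : x ≠ 0) (h : d ^ q = x ^ M) : ∃ y : F, y ^ q = x := by
  have hcop : Nat.Coprime M q := ((hq.coprime_iff_not_dvd).2 hM).symm
  obtain ⟨s, hs⟩ := Nat.exists_mul_mod_eq_one_of_coprime hcop hq.one_lt
  have h1 : M * s = q * (M * s / q) + 1 := by
    conv_lhs => rw [← Nat.div_add_mod (M * s) q, hs.2]
  refine ⟨d ^ s / x ^ (M * s / q), ?_⟩
  rw [div_pow, ← pow_mul, ← pow_mul, mul_comm s, pow_mul, h, ← pow_mul,
    div_eq_iff (pow_ne_zero _ hx), mul_comm (M * s / q), ← pow_succ', ← h1]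

/-- For a nonzero covector `x` modulo `q` there is a prime modulo which the only products of the
`p i` that are `q`-th powers are those whose vector of exponents is annihilated by `x`. -/
theorem exists_prime_forall_sum_eq_zero {q k : ℕ} (hq : q.Prime) {p : Fin k → ℕ}
    (hp : ∀ i, (p i).Prime) (hpinj : Function.Injective p) {x : Fin k → ZMod q} (hx : x ≠ 0) :
    ∃ r : ℕ, r.Prime ∧ ∀ (e : Fin k → ℕ) (c : ℤ), (r : ℤ) ∣ c ^ q - ∏ i, (p i : ℤ) ^ e i →
      ∑ i, (e i : ZMod q) * x i = 0 := by
  have : Fact q.Prime := ⟨hq⟩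
  have : NeZero q := ⟨hq.ne_zero⟩
  obtain ⟨i₀, hi₀⟩ := Function.ne_iff.1 hx
  replace hi₀ : x i₀ ≠ 0 := hi₀
  let m : Fin k → ℕ := fun i ↦ (-x i / x i₀).val
  have hm : ∀ i, (m i : ZMod q) = -x i / x i₀ := fun i ↦ ZMod.natCast_zmod_val _
  have hprod : ∀ {R : Type} [CommRing R] (e : Fin k → ℕ),
      ∏ i, ((p i : R) * (p i₀ : R) ^ m i) ^ e i =
        (∏ i, (p i : R) ^ e i) * (p i₀ : R) ^ ∑ i, m i * e i := by
    intro R _ e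
    simp_rw [mul_pow, Finset.prod_mul_distrib, ← pow_mul]
    rw [Finset.prod_pow_eq_pow_sum]
  obtain ⟨K, _, _, _⟩ := exists_numberField_isCyclotomicExtension q
  have hζ := IsCyclotomicExtension.zeta_spec q ℚ K
  have hcast : ∀ i, (p i : K) ≠ 0 := fun i ↦ Nat.cast_ne_zero.2 (hp i).ne_zero
  obtain ⟨L, _, _, _, hb, ha⟩ := exists_extension_forall_eq_pow hq k K _ hζ
    (fun i ↦ (p i : K) * (p i₀ : K) ^ m i)
    (p i₀ : K) (fun i ↦ mul_ne_zero (hcast i) (pow_ne_zero _ (hcast i₀)))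
    fun e c hc ↦ by
      rw [hprod] at hc
      have h0 : ∏ i, p i ^ e i ≠ 0 :=
        Finset.prod_ne_zero_iff.2 fun i _ ↦ pow_ne_zero _ (hp i).ne_zero
      have h1 : ∀ i, q ∣ (p i₀ * ((∏ i, p i ^ e i) * p i₀ ^ ∑ i, m i * e i)).factorization (p i) := by
        refine fun i ↦ dvd_factorization_of_eq_pow hq (mul_ne_zero (hp i₀).ne_zero (mul_ne_zero h0
          (pow_ne_zero _ (hp i₀).ne_zero))) (c := c) ?_ (hp i)
        rw [hc]
        push_cast
        rfl
      have h2 : ∀ i, i ≠ i₀ → (e i : ZMod q) = 0 := by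
        intro i hi
        have hne : p i₀ ≠ p i := fun h ↦ hi (hpinj h.symm)
        have := h1 i
        rw [Nat.factorization_mul (hp i₀).ne_zero (mul_ne_zero h0 (pow_ne_zero _ (hp i₀).ne_zero)),
          Nat.factorization_mul h0 (pow_ne_zero _ (hp i₀).ne_zero), (hp i₀).factorization_pow,
          (hp i₀).factorization, Finsupp.add_apply, Finsupp.add_apply,
          factorization_prod_prime_pow hp hpinj, Finsupp.single_eq_of_ne hne.symm,
          Finsupp.single_eq_of_ne hne.symm, zero_add, add_zero] at this
        exact (ZMod.natCast_eq_zero_iff _ _).2 this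
      have h3 := h1 i₀
      rw [Nat.factorization_mul (hp i₀).ne_zero (mul_ne_zero h0 (pow_ne_zero _ (hp i₀).ne_zero)),
          Nat.factorization_mul h0 (pow_ne_zero _ (hp i₀).ne_zero), (hp i₀).factorization_pow,
          (hp i₀).factorization, Finsupp.add_apply, Finsupp.add_apply,
          factorization_prod_prime_pow hp hpinj, Finsupp.single_eq_same,
          Finsupp.single_eq_same, ← ZMod.natCast_eq_zero_iff] at h3
      push_cast at h3
      rw [Finset.sum_eq_single i₀ (fun i _ hi ↦ by rw [h2 i hi, mul_zero])
        (fun h ↦ absurd (mem_univ _) h), hm, neg_div, div_self hi₀] at h3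
      simp at h3
  have hroot : ∀ i, ∃ β : 𝓞 L, β ^ q = (p i : 𝓞 L) * (p i₀ : 𝓞 L) ^ m i := by
    intro i
    obtain ⟨c, hc⟩ := hb i
    rw [map_mul, map_pow, map_natCast, map_natCast] at hc
    have h_int : IsIntegral ℤ c := by
      refine .of_pow hq.pos ?_
      rw [hc]
      exact_mod_cast (p i * p i₀ ^ m i : 𝓞 L).2
    exact ⟨⟨c, h_int⟩, RingOfIntegers.ext (hc.trans (by simp))⟩
  choose β hβ using hroot
  have hinf := infinite_setOf_forall_sub_pow_notMem hq
    (hζ.map_of_injective (algebraMap K L).injective) (a := (p i₀ : 𝓞 L))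
    fun c hc ↦ ha c (by simpa using hc)
  have hfin : (⋃ i, {P : Ideal (𝓞 L) | (p i : 𝓞 L) ∈ P}).Finite := Set.finite_iUnion fun i ↦
    Ideal.finite_setOf_mem (Nat.cast_ne_zero.2 (hp i).ne_zero)
  obtain ⟨P, ⟨hP, hr, hPa⟩, hPp⟩ := (hinf.sdiff hfin).nonempty
  simp only [Set.mem_iUnion, Set.mem_ofPred_eq, not_exists] at hPp
  refine ⟨Ideal.absNorm P, hr, fun e c hc ↦ ?_⟩
  have hPm : P.IsMaximal := (Ideal.isPrime_of_prime hP).isMaximal hP.ne_zero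
  let _ := Ideal.Quotient.field P
  have hne : ∀ i, (p i : 𝓞 L ⧸ P) ≠ 0 := fun i h ↦ hPp i <| by
    rwa [← Ideal.Quotient.eq_zero_iff_mem, map_natCast]
  have h1 : (c : 𝓞 L ⧸ P) ^ q = ∏ i, (p i : 𝓞 L ⧸ P) ^ e i := by
    have h2 : ((c ^ q - ∏ i, (p i : ℤ) ^ e i : ℤ) : 𝓞 L) ∈ P := by
      obtain ⟨d, hd⟩ := hc
      rw [hd, Int.cast_mul]
      exact P.mul_mem_right _ (by simpa using Ideal.absNorm_mem P)
    rw [← Ideal.Quotient.eq_zero_iff_mem, map_intCast] at h2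
    push_cast at h2
    exact sub_eq_zero.1 h2
  have hβ' : ∀ i, (Ideal.Quotient.mk P (β i)) ^ q = (p i : 𝓞 L ⧸ P) * (p i₀ : 𝓞 L ⧸ P) ^ m i := by
    intro i
    rw [← map_pow, hβ, map_mul, map_pow, map_natCast, map_natCast]
  have hc0 : (c : 𝓞 L ⧸ P) ≠ 0 := by
    intro h
    rw [h, zero_pow hq.ne_zero, eq_comm, Finset.prod_eq_zero_iff] at h1
    obtain ⟨i, -, hi⟩ := h1
    exact hne i (eq_zero_of_pow_eq_zero hi)
  have h3 : ((∏ i, Ideal.Quotient.mk P (β i) ^ e i) / c) ^ q =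
      (p i₀ : 𝓞 L ⧸ P) ^ ∑ i, m i * e i := by
    rw [div_pow, div_eq_iff (pow_ne_zero _ hc0), ← Finset.prod_pow]
    simp_rw [← pow_mul, mul_comm (e _) q, pow_mul, hβ']
    rw [hprod, h1, mul_comm]
  have h4 : q ∣ ∑ i, m i * e i := by
    by_contra hM
    obtain ⟨y, hy⟩ := exists_pow_eq_of_pow_eq_pow hq hM (hne i₀) h3
    obtain ⟨y, rfl⟩ := Ideal.Quotient.mk_surjective y
    refine hPa y ?_
    rw [← Ideal.Quotient.eq_zero_iff_mem, map_sub, map_pow, hy, map_natCast, sub_self]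
  rw [← ZMod.natCast_eq_zero_iff] at h4
  push_cast at h4
  simp_rw [hm] at h4
  have h5 : ∑ i, (e i : ZMod q) * x i = -x i₀ * ∑ i, -x i / x i₀ * e i := by
    rw [Finset.mul_sum]
    refine Finset.sum_congr rfl fun i _ ↦ ?_
    field_simp
  rw [h5, h4, mul_zero]

lemma exists_eq_mul_prod_prime_pow {ι : Type*} [Fintype ι] {p : ι → ℕ} (hp : ∀ i, (p i).Prime)
    (hpinj : Function.Injective p) {a : ℤ} (ha : a ≠ 0)
    (hall : ∀ r : ℕ, r.Prime → (r : ℤ) ∣ a → ∃ i, p i = r) {e : ι → ℕ}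
    (he : ∀ i, (p i : ℤ) ^ e i ∣ a ∧ ¬ (p i : ℤ) ^ (e i + 1) ∣ a) :
    ∃ ε : ℤ, (ε = 1 ∨ ε = -1) ∧ a = ε * ∏ i, (p i : ℤ) ^ e i := by
  have hdvd : ∀ r n : ℕ, (r : ℤ) ^ n ∣ a ↔ r ^ n ∣ a.natAbs := fun r n ↦ by
    rw [← Int.natCast_dvd, Nat.cast_pow]
  have ha' : a.natAbs ≠ 0 := Int.natAbs_ne_zero.2 ha
  have h : a.natAbs = ∏ i, p i ^ e i := by
    refine Nat.eq_of_factorization_eq ha'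
      (Finset.prod_ne_zero_iff.2 fun i _ ↦ pow_ne_zero _ (hp i).ne_zero) fun r ↦ ?_
    by_cases hr : r.Prime
    · by_cases hi : ∃ i, p i = r
      · obtain ⟨i, rfl⟩ := hi
        rw [factorization_prod_prime_pow hp hpinj]
        obtain ⟨h1, h2⟩ := he i
        rw [hdvd, hr.pow_dvd_iff_le_factorization ha'] at h1 h2
        omega
      · rw [Nat.factorization_eq_zero_of_not_dvd fun h ↦ hi (hall r hr (Int.natCast_dvd.2 h)),
          Nat.factorization_eq_zero_of_not_dvd]
        intro h
        obtain ⟨i, -, h⟩ := (hr.prime.dvd_finsetProd_iff _).1 h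
        exact hi ⟨i, ((Nat.prime_dvd_prime_iff_eq hr (hp i)).1 (hr.dvd_of_dvd_pow h)).symm⟩
    · rw [Nat.factorization_eq_zero_of_not_prime _ hr, Nat.factorization_eq_zero_of_not_prime _ hr]
  have h' : (a.natAbs : ℤ) = ∏ i, (p i : ℤ) ^ e i := by
    rw [h]
    push_cast
    rfl
  rw [← h']
  obtain h1 | h1 := Int.natAbs_eq a
  · exact ⟨1, .inl rfl, by rw [one_mul]; exact h1⟩
  · exact ⟨-1, .inr rfl, by rw [neg_one_mul]; exact h1⟩

lemma exists_pow_dvd_of_pow_mul_card_dvd_prod {ι : Type*} {r : ℤ} (hr : Prime r) {n : ℕ}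
    {f : ι → ℤ} {s : Finset ι} (hs : s.Nonempty) (h : r ^ (n * s.card) ∣ ∏ j ∈ s, f j) :
    ∃ j ∈ s, r ^ n ∣ f j := by
  induction hs using Finset.Nonempty.cons_induction with
  | singleton a => exact ⟨a, mem_singleton_self a, by simpa using h⟩
  | cons a s has hs ih =>
    rw [prod_cons, card_cons, pow_dvd_iff_le_emultiplicity, emultiplicity_mul hr] at h
    by_cases ha : r ^ n ∣ f a
    · exact ⟨a, mem_cons_self a s, ha⟩
    obtain ⟨j, hj, hj'⟩ := ih (by
      by_contra hP
      rw [pow_dvd_iff_le_emultiplicity, not_le] at ha hP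
      obtain ⟨u, hu⟩ := ENat.ne_top_iff_exists.1 ha.ne_top
      obtain ⟨v, hv⟩ := ENat.ne_top_iff_exists.1 hP.ne_top
      rw [← hu] at h ha
      rw [← hv] at h hP
      norm_cast at h ha hP
      rw [mul_add] at h
      omega)
    exact ⟨j, mem_cons_of_mem hj, hj'⟩

lemma not_dvd_of_pow_dvd_pow_sub {r : ℤ} (hr : Prime r) {q : ℕ} (hq : q ≠ 0) {x a : ℤ}
    (h : r ^ q ∣ x ^ q - a) (ha : ¬ r ^ q ∣ a) : ¬ r ∣ a := by
  intro hra
  have h1 : r ∣ x := hr.dvd_of_dvd_pow ((dvd_sub_left hra).1 ((dvd_pow_self r hq).trans h))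
  exact ha ((dvd_sub_right (pow_dvd_pow_of_dvd h1 q)).1 h)

lemma exists_pow_dvd_pow_sub_of_norm_lt {r : ℕ} [Fact r.Prime] {q : ℕ} {y a : ℤ}
    (h : ‖((y ^ q - a : ℤ) : ℤ_[r])‖ < ‖(q : ℤ_[r]) * (y : ℤ_[r]) ^ (q - 1)‖ ^ 2) (n : ℕ) :
    ∃ x : ℤ, (r : ℤ) ^ n ∣ x ^ q - a := by
  let F : Polynomial ℤ_[r] := Polynomial.X ^ q - Polynomial.C (a : ℤ_[r])
  obtain ⟨z, hz, -⟩ := hensels_lemma (F := F) (a := (y : ℤ_[r])) (by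
    simpa [F, Polynomial.derivative_X_pow] using h)
  have hz' : z ^ q = a := by
    rw [← sub_eq_zero]
    simpa [F] using hz
  refine ⟨z.appr n, ?_⟩
  rw [← PadicInt.pow_p_dvd_int_iff]
  have h1 : (r : ℤ_[r]) ^ n ∣ z - z.appr n :=
    Ideal.mem_span_singleton.1 (PadicInt.appr_spec n z)
  have h2 := h1.trans (sub_dvd_pow_sub_pow z (z.appr n) q)
  rw [hz', dvd_sub_comm] at h2
  exact_mod_cast h2

lemma exists_pow_dvd_pow_sub_of_ne {r q : ℕ} (hr : r.Prime) (hq : q.Prime) (hrq : r ≠ q) {y a : ℤ}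
    (ha : ¬ (r : ℤ) ∣ a) (h : (r : ℤ) ∣ y ^ q - a) (n : ℕ) :
    ∃ x : ℤ, (r : ℤ) ^ n ∣ x ^ q - a := by
  have : Fact r.Prime := ⟨hr⟩
  have hy : ¬ (r : ℤ) ∣ y := fun hy ↦ ha ((dvd_sub_right (dvd_pow hy hq.ne_zero)).1 h)
  refine exists_pow_dvd_pow_sub_of_norm_lt (y := y) ?_ n
  have h1 : ‖(y : ℤ_[r])‖ = 1 :=
    le_antisymm (PadicInt.norm_le_one _)
      (not_lt.1 fun h ↦ hy ((PadicInt.norm_int_lt_one_iff_dvd _).1 h))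
  have h2 : ‖(q : ℤ_[r])‖ = 1 := by
    refine le_antisymm (PadicInt.norm_le_one _) (not_lt.1 fun h ↦ hrq ?_)
    rw [← Int.cast_natCast, PadicInt.norm_int_lt_one_iff_dvd, Int.natCast_dvd_natCast,
      Nat.prime_dvd_prime_iff_eq hr hq] at h
    exact h
  rw [norm_mul, norm_pow, h1, h2, one_pow, mul_one, one_pow]
  exact (PadicInt.norm_int_lt_one_iff_dvd _).2 h

lemma exists_pow_dvd_pow_sub_of_pow_self_dvd {q : ℕ} (hq : q.Prime) (hq2 : 2 < q) {y a : ℤ}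
    (ha : ¬ (q : ℤ) ^ q ∣ a) (h : (q : ℤ) ^ q ∣ y ^ q - a) (n : ℕ) :
    ∃ x : ℤ, (q : ℤ) ^ n ∣ x ^ q - a := by
  have : Fact q.Prime := ⟨hq⟩
  have hy : ¬ (q : ℤ) ∣ y := fun hy ↦ ha ((dvd_sub_right (pow_dvd_pow_of_dvd hy q)).1 h)
  refine exists_pow_dvd_pow_sub_of_norm_lt (y := y) ?_ n
  have h1 : ‖(y : ℤ_[q])‖ = 1 :=
    le_antisymm (PadicInt.norm_le_one _)
      (not_lt.1 fun h ↦ hy ((PadicInt.norm_int_lt_one_iff_dvd _).1 h))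
  rw [norm_mul, norm_pow, h1, one_pow, mul_one, PadicInt.norm_p]
  refine (PadicInt.norm_int_le_pow_iff_dvd.2 (by exact_mod_cast h)).trans_lt ?_
  rw [zpow_neg, zpow_natCast, inv_pow]
  have hq1 : (1 : ℝ) < q := by exact_mod_cast hq.one_lt
  exact inv_strictAnti₀ (by positivity) (pow_lt_pow_right₀ hq1 hq2)

lemma exists_dvd_eval_of_forall_prime_pow (f : Polynomial ℤ)
    (h : ∀ r : ℕ, r.Prime → ∀ n : ℕ, ∃ x : ℤ, (r : ℤ) ^ n ∣ f.eval x) (m : ℕ) (hm : 0 < m) :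
    ∃ x : ℤ, (m : ℤ) ∣ f.eval x := by
  induction m using Nat.recOnPosPrimePosCoprime with
  | zero => exact absurd hm (lt_irrefl 0)
  | one => exact ⟨0, by simp⟩
  | prime_pow r n hr hn =>
    obtain ⟨x, hx⟩ := h r hr n
    exact ⟨x, by exact_mod_cast hx⟩
  | coprime u v hu hv huv ihu ihv =>
    obtain ⟨x, hx⟩ := ihu (by omega)
    obtain ⟨y, hy⟩ := ihv (by omega)
    have hcop : IsCoprime (u : ℤ) v := Nat.isCoprime_iff_coprime.2 huv
    obtain ⟨s, t, hst⟩ := id hcop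
    refine ⟨x * (t * v) + y * (s * u), ?_⟩
    rw [Nat.cast_mul]
    refine hcop.mul_dvd ?_ ?_
    · refine (dvd_iff_dvd_of_dvd_sub ((Dvd.intro ((y - x) * s) ?_).trans
        (Polynomial.sub_dvd_eval_sub _ x f))).2 hx
      linear_combination -x * hst
    · refine (dvd_iff_dvd_of_dvd_sub ((Dvd.intro ((x - y) * t) ?_).trans
        (Polynomial.sub_dvd_eval_sub _ y f))).2 hy
      linear_combination -y * hst

/-- If the hyperplanes with coefficients `e j` cover `(ZMod q) ^ ι`, then modulo each prime not
dividing the `p i`, one of the products `∏ i, p i ^ e j i` is a `q`-th power. -/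
lemma exists_dvd_pow_sub_prod_of_covering {ι κ : Type*} [Fintype ι] {q r : ℕ} (hr : r.Prime)
    {p : ι → ℕ} (hp : ∀ i, ¬ r ∣ p i) {e : κ → ι → ℕ}
    (hcov : ∀ x : ι → ZMod q, ∃ j, ∑ i, (e j i : ZMod q) * x i = 0) :
    ∃ j, ∃ y : ℤ, (r : ℤ) ∣ y ^ q - ∏ i, (p i : ℤ) ^ e j i := by
  have : Fact r.Prime := ⟨hr⟩
  obtain ⟨g, hg⟩ := IsCyclic.exists_monoid_generator (α := (ZMod r)ˣ)
  have hlog : ∀ i, ∃ n : ℕ, ((g : ZMod r)) ^ n = p i := by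
    intro i
    have h0 : (p i : ZMod r) ≠ 0 := mt (ZMod.natCast_eq_zero_iff _ _).1 (hp i)
    obtain ⟨n, hn⟩ := Submonoid.mem_powers_iff _ _ |>.1 (hg (Units.mk0 _ h0))
    exact ⟨n, by rw [← Units.val_pow_eq_pow_val, hn, Units.val_mk0]⟩
  choose n hn using hlog
  obtain ⟨j, hj⟩ := hcov fun i ↦ n i
  have hj' : q ∣ ∑ i, e j i * n i := by
    rw [← ZMod.natCast_eq_zero_iff]
    push_cast
    exact hj
  obtain ⟨s, hs⟩ := hj'
  refine ⟨j, ((g : ZMod r) ^ s).val, ?_⟩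
  rw [← ZMod.intCast_zmod_eq_zero_iff_dvd]
  push_cast
  rw [ZMod.natCast_zmod_val, sub_eq_zero, ← pow_mul, mul_comm s, ← hs,
    ← Finset.prod_pow_eq_pow_sum]
  exact Finset.prod_congr rfl fun i _ ↦ by rw [mul_comm, pow_mul, hn]

end PowerIntersective

/-- Theorem (main result): necessary and sufficient conditions for
`∏ j (x^q - a j)` to have roots modulo every positive integer. -/
theorem stmt0 (q : ℕ) (hq : q.Prime) (hq_odd : Odd q)
    (l : ℕ) (hl : 1 ≤ l) (a : Fin l → ℤ)
    (ha0 : ∀ j, a j ≠ 0)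
    (haqf : ∀ j, ∀ r : ℕ, r.Prime → ¬ ((r : ℤ) ^ q ∣ a j))
    (ha1 : ∀ j, a j ≠ 1) (ham1 : ∀ j, a j ≠ -1)
    (k : ℕ) (hk : 2 ≤ k) (p : Fin k → ℕ)
    (hp : ∀ i, (p i).Prime) (hpinj : Function.Injective p)
    (hpall : ∀ r : ℕ, r.Prime → ((r : ℤ) ∣ ∏ j, a j ↔ ∃ i, p i = r))
    (ν : Fin k → Fin l → ℕ)
    (hν : ∀ i j, ((p i : ℤ)) ^ (ν i j) ∣ a j ∧ ¬ ((p i : ℤ)) ^ (ν i j + 1) ∣ a j) :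
    (∀ m : ℕ, 0 < m → ∃ x : ℤ, (m : ℤ) ∣ ∏ j, (x ^ q - a j)) ↔
      ((∀ x : Fin k → ZMod q, ∃ j, ∑ i, (ν i j : ZMod q) * x i = 0) ∧
       (∃ j, ∃ y : ℤ, ((q : ℤ)) ^ q ∣ y ^ q - a j) ∧
       (∀ i, ∃ j, ¬ ((p i : ℤ) ∣ a j) ∧ ∃ y : ℤ, (p i : ℤ) ∣ y ^ q - a j)) := by
  have hne : Nonempty (Fin l) := ⟨⟨0, hl⟩⟩
  have hq2 : 2 < q := by
    obtain ⟨t, rfl⟩ := hq_odd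
    have := hq.two_le
    omega
  have hall : ∀ j, ∀ r : ℕ, r.Prime → (r : ℤ) ∣ a j → ∃ i, p i = r := fun j r hr h ↦
    (hpall r hr).1 (h.trans (Finset.dvd_prod_of_mem a (Finset.mem_univ j)))
  have hdec : ∀ j, ∃ ε : ℤ, (ε = 1 ∨ ε = -1) ∧ a j = ε * ∏ i, (p i : ℤ) ^ ν i j := fun j ↦
    PowerIntersective.exists_eq_mul_prod_prime_pow hp hpinj (ha0 j) (hall j) fun i ↦ hν i j
  choose ε hε ha using hdec
  have hεq : ∀ j, ε j ^ q = ε j := fun j ↦ by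
    rcases hε j with h | h <;> simp [h, hq_odd.neg_one_pow]
  have hεε : ∀ j, ε j * ε j = 1 := fun j ↦ by
    rcases hε j with h | h <;> simp [h]
  constructor
  · intro h
    have hloc : ∀ r : ℕ, r.Prime → ∃ j, ¬ (r : ℤ) ∣ a j ∧ ∃ y : ℤ, (r : ℤ) ^ q ∣ y ^ q - a j := by
      intro r hr
      obtain ⟨x, hx⟩ := h (r ^ (q * l)) (pow_pos hr.pos _)
      obtain ⟨j, -, hj⟩ := PowerIntersective.exists_pow_dvd_of_pow_mul_card_dvd_prod
        (Nat.prime_iff_prime_int.1 hr) (n := q) (f := fun j ↦ x ^ q - a j) Finset.univ_nonempty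
        (by rw [Finset.card_univ, Fintype.card_fin]; exact_mod_cast hx)
      exact ⟨j, PowerIntersective.not_dvd_of_pow_dvd_pow_sub (Nat.prime_iff_prime_int.1 hr)
        hq.ne_zero hj (haqf j r hr), x, hj⟩
    refine ⟨fun x ↦ ?_, ?_, fun i ↦ ?_⟩
    · obtain rfl | hx := eq_or_ne x 0
      · exact ⟨⟨0, hl⟩, by simp⟩
      obtain ⟨r, hr, hrx⟩ := PowerIntersective.exists_prime_forall_sum_eq_zero hq hp hpinj hx
      obtain ⟨y, hy⟩ := h r hr.pos
      obtain ⟨j, -, hj⟩ := ((Nat.prime_iff_prime_int.1 hr).dvd_finsetProd_iff _).1 hy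
      refine ⟨j, hrx (fun i ↦ ν i j) (ε j * y) (hj.trans (Dvd.intro (ε j) ?_))⟩
      rw [ha j, mul_pow, hεq]
      linear_combination -(∏ i, (p i : ℤ) ^ ν i j) * hεε j
    · obtain ⟨j, -, hj⟩ := hloc q hq
      exact ⟨j, hj⟩
    · obtain ⟨j, hj, y, hy⟩ := hloc (p i) (hp i)
      exact ⟨j, hj, y, (dvd_pow_self _ hq.ne_zero).trans hy⟩
  · rintro ⟨hcov, ⟨j₁, y₁, h₁⟩, hloc⟩ m hm
    have hpp : ∀ r : ℕ, r.Prime → ∃ j, ∀ n : ℕ, ∃ x : ℤ, (r : ℤ) ^ n ∣ x ^ q - a j := by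
      intro r hr
      obtain rfl | hrq := eq_or_ne r q
      · exact ⟨j₁, PowerIntersective.exists_pow_dvd_pow_sub_of_pow_self_dvd hq hq2
          (haqf j₁ r hr) h₁⟩
      by_cases hi : ∃ i, p i = r
      · obtain ⟨i, rfl⟩ := hi
        obtain ⟨j, hj, y, hy⟩ := hloc i
        exact ⟨j, PowerIntersective.exists_pow_dvd_pow_sub_of_ne hr hq hrq hj hy⟩
      · obtain ⟨j, y, hy⟩ := PowerIntersective.exists_dvd_pow_sub_prod_of_covering
          (e := fun j i ↦ ν i j) hr (fun i hri ↦ hi ⟨i, ((Nat.prime_dvd_prime_iff_eq hr (hp i)).1 hri).symm⟩)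
          hcov
        refine ⟨j, PowerIntersective.exists_pow_dvd_pow_sub_of_ne (y := ε j * y) hr hq hrq
          (fun h ↦ hi (hall j r hr h)) (hy.trans (Dvd.intro (ε j) ?_))⟩
        rw [ha j, mul_pow, hεq]
        ring
    obtain ⟨x, hx⟩ := PowerIntersective.exists_dvd_eval_of_forall_prime_pow
      (∏ j, (Polynomial.X ^ q - Polynomial.C (a j))) (fun r hr n ↦ by
        obtain ⟨j, hj⟩ := hpp r hr
        obtain ⟨x, hx⟩ := hj n
        refine ⟨x, ?_⟩
        rw [Polynomial.eval_prod]
        refine Dvd.dvd.trans ?_ (Finset.dvd_prod_of_mem _ (Finset.mem_univ j))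
        simpa using hx) m hm
    refine ⟨x, ?_⟩
    rw [Polynomial.eval_prod] at hx
    simpa using hx
end

section
/- Let q be a prime and let V be a vector space over the field ℤ/qℤ with dimension at least 2. Then the linear covering number of V equals q + 1; that is, (a) there exist q + 1 proper subspaces of V whose union is all of V, and (b) any finite collection of proper subspaces of V whose union is all of V has cardinality at least q + 1. -/
/-- Finitely many proper subspaces, at most as many as there are scalars, do not cover the space. -/
theorem exists_forall_notMem_of_card_le {K V : Type*} [Field K] [Fintype K] [AddCommGroup V]
    [Module K V] (s : Finset (Submodule K V)) (hs : ∀ W ∈ s, W ≠ ⊤)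
    (hcard : s.card ≤ Fintype.card K) : ∃ v : V, ∀ W ∈ s, v ∉ W := by
  classical
  induction s using Finset.induction_on with
  | empty => simp
  | insert W s hW ih =>
    rw [Finset.card_insert_of_notMem hW] at hcard
    obtain ⟨v, hv⟩ := ih (fun U hU ↦ hs U (Finset.mem_insert_of_mem hU)) (by omega)
    by_cases hvW : v ∈ W
    · obtain ⟨w, hw⟩ : ∃ w, w ∉ W := by
        by_contra! h
        exact hs W (Finset.mem_insert_self _ _) (Submodule.eq_top_iff'.2 h)
      obtain ⟨c, hc⟩ : ∃ c : K, ∀ U ∈ s, w + c • v ∉ U := by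
        by_contra! h
        choose U hU hmem using h
        have hle : Finset.univ.card ≤ s.card :=
          Finset.card_le_card_of_injOn U (fun c _ ↦ hU c) fun c _ d _ hcd ↦ by
            by_contra hne
            have hd := hmem d
            rw [← hcd] at hd
            have hsub : (c - d) • v ∈ U c := by
              simpa [sub_smul] using (U c).sub_mem (hmem c) hd
            exact hv _ (hU c) (((U c).smul_mem_iff (sub_ne_zero.2 hne)).1 hsub)
        rw [Finset.card_univ] at hle
        omega
      refine ⟨w + c • v, (Finset.forall_mem_insert _ _ _).2 ⟨fun h ↦ hw ?_, hc⟩⟩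
      exact (W.add_mem_iff_left (W.smul_mem c hvW)).1 h
    · exact ⟨v, (Finset.forall_mem_insert _ _ _).2 ⟨hvW, hv⟩⟩

/-- A space of dimension at least 2 is covered by the preimages of the lines of a
two-dimensional quotient. -/
theorem exists_finset_submodule_cover {K V : Type*} [Field K] [Fintype K] [AddCommGroup V]
    [Module K V] (hdim : 2 ≤ Module.rank K V) :
    ∃ s : Finset (Submodule K V), s.card = Fintype.card K + 1 ∧
      (∀ W ∈ s, W ≠ ⊤) ∧ ∀ v : V, ∃ W ∈ s, v ∈ W := by
  classical
  let b := Module.Free.chooseBasis K V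
  obtain ⟨i, j, hij⟩ : ∃ i j : Module.Free.ChooseBasisIndex K V, i ≠ j := by
    rw [← b.mk_eq_rank''] at hdim
    exact Cardinal.two_le_iff.1 hdim
  let φ : Option K → V →ₗ[K] K := fun o ↦ o.elim (b.coord j) fun c ↦ b.coord i - c • b.coord j
  have hinj : Function.Injective fun o ↦ LinearMap.ker (φ o) := by
    rintro (_ | c) (_ | d) h
    · rfl
    · simpa [φ, hij, hij.symm] using SetLike.ext_iff.1 h (b i)
    · simpa [φ, hij, hij.symm] using SetLike.ext_iff.1 h (b i)
    · simpa [φ, hij, hij.symm, sub_eq_zero] using SetLike.ext_iff.1 h (c • b i + b j)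
  refine ⟨Finset.univ.map ⟨_, hinj⟩, by simp, ?_, fun v ↦ ?_⟩
  · simp only [Finset.mem_map, Finset.mem_univ, true_and, Function.Embedding.coeFn_mk]
    rintro _ ⟨_ | c, rfl⟩ h
    · simpa [φ] using Submodule.eq_top_iff'.1 h (b j)
    · simpa [φ, hij] using Submodule.eq_top_iff'.1 h (b i)
  · by_cases hv : b.coord j v = 0
    · exact ⟨_, Finset.mem_map_of_mem _ (Finset.mem_univ none), hv⟩
    · refine ⟨_, Finset.mem_map_of_mem _ (Finset.mem_univ (some (b.coord i v / b.coord j v))), ?_⟩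
      change b.coord i v - b.coord i v / b.coord j v * b.coord j v = 0
      rw [div_mul_cancel₀ _ hv, sub_self]

/-- The linear covering number of a vector space of dimension at least 2
over `ℤ/qℤ` (q prime) equals `q + 1`. -/
theorem stmt1 (q : ℕ) [Fact q.Prime] (V : Type*) [AddCommGroup V]
    [Module (ZMod q) V] (hdim : 2 ≤ Module.rank (ZMod q) V) :
    (∃ s : Finset (Submodule (ZMod q) V), s.card = q + 1 ∧
      (∀ W ∈ s, W ≠ ⊤) ∧ ∀ v : V, ∃ W ∈ s, v ∈ W) ∧
    (∀ s : Finset (Submodule (ZMod q) V), (∀ W ∈ s, W ≠ ⊤) →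
      (∀ v : V, ∃ W ∈ s, v ∈ W) → q + 1 ≤ s.card) := by
  refine ⟨by simpa only [ZMod.card] using exists_finset_submodule_cover hdim,
    fun s hs hcover ↦ ?_⟩
  by_contra! hlt
  obtain ⟨v, hv⟩ := exists_forall_notMem_of_card_le s hs (by rw [ZMod.card]; omega)
  obtain ⟨W, hW, hvW⟩ := hcover v
  exact hv W hW hvW
end

section
/- Let q be an odd prime and let A = {a_1, a_2, …, a_l} be a finite set of non-zero integers, none of which is a perfect q-th power. Let p_1, p_2, …, p_k (with k ≥ 2) be all the distinct primes whose exponent in the factorization of some a_j is not divisible by q, and for each i, j let ν_{ij} ∈ {0, 1, …, q−1} be the exponent of p_i in a_j reduced modulo q. Then the following three conditions are equivalent: (1) the set of primes p such that some a_j is a q-th power modulo p has relative asymptotic density 1 in the primes, i.e., the ratio #{primes p ≤ N : some a_j is a q-th power mod p} / #{primes p ≤ N} tends to 1 as N → ∞; (2) for every prime p not in the set {q, p_1, p_2, …, p_k}, some a_j is a q-th power modulo p; (3) for every vector (x_1, …, x_k) ∈ (ℤ/qℤ)^k there exists some j ∈ {1, …, l} with ν_{1j}·x_1 + ν_{2j}·x_2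 + ⋯ + ν_{kj}·x_k = 0 in ℤ/qℤ. -/
section

open NumberField Filter Topology IsDedekindDomain Polynomial

section
variable (K : Type*) [Field K] [NumberField K]

theorem eventually_summable_absNorm_rpow :
    ∀ᶠ s : ℝ in 𝓝[>] 1, Summable (fun I : Ideal (𝓞 K) ↦ (Ideal.absNorm I : ℝ) ^ (-s)) ∧
      dedekindZeta K s = ((∑' I : Ideal (𝓞 K), (Ideal.absNorm I : ℝ) ^ (-s) : ℝ) : ℂ) := by
  have h0 := (tendsto_sub_one_mul_dedekindZeta_nhdsGT K).eventually_ne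
    (Complex.ofReal_ne_zero.mpr (dedekindZeta_residue_ne_zero K))
  filter_upwards [h0, self_mem_nhdsWithin] with s hs hs1
  have hs1' : (1 : ℝ) < s := hs1
  have hz : dedekindZeta K s ≠ 0 := right_ne_zero_of_mul hs
  have hterm : ∀ n : ℕ, LSeries.term (fun n ↦ (Nat.card {I : Ideal (𝓞 K) // Ideal.absNorm I = n} : ℂ)) s n
      = ((Nat.card {I : Ideal (𝓞 K) // Ideal.absNorm I = n} * (n : ℝ) ^ (-s) : ℝ) : ℂ) := by
    intro n
    rcases eq_or_ne n 0 with rfl | hn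
    · have : (0:ℝ) ^ (-s) = 0 := Real.zero_rpow (by linarith)
      simp [this]
    · rw [LSeries.term_of_ne_zero hn, Complex.ofReal_mul, Complex.ofReal_cpow (by positivity),
        div_eq_mul_inv, ← Complex.cpow_neg]
      simp
  have hsum : Summable (LSeries.term
      (fun n ↦ (Nat.card {I : Ideal (𝓞 K) // Ideal.absNorm I = n} : ℂ)) s) := by
    by_contra h
    exact hz (tsum_eq_zero_of_not_summable h)
  have hζ : dedekindZeta K s = ∑' n, LSeries.term
      (fun n ↦ (Nat.card {I : Ideal (𝓞 K) // Ideal.absNorm I = n} : ℂ)) s n := rfl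
  rw [funext hterm, Complex.summable_ofReal] at hsum
  rw [funext hterm, ← Complex.ofReal_tsum] at hζ
  have hfib : ∀ n : ℕ, HasSum (fun I : {I : Ideal (𝓞 K) // Ideal.absNorm I = n} ↦
      (Ideal.absNorm I.1 : ℝ) ^ (-s))
      (Nat.card {I : Ideal (𝓞 K) // Ideal.absNorm I = n} * (n : ℝ) ^ (-s)) := by
    intro n
    have : Finite {I : Ideal (𝓞 K) // Ideal.absNorm I = n} :=
      Ideal.finite_setOfPred_absNorm_eq n
    have := Fintype.ofFinite {I : Ideal (𝓞 K) // Ideal.absNorm I = n}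
    convert! hasSum_fintype (fun I : {I : Ideal (𝓞 K) // Ideal.absNorm I = n} ↦
      (Ideal.absNorm I.1 : ℝ) ^ (-s)) using 1
    rw [Finset.sum_congr rfl (fun I _ ↦ by rw [I.2]), Finset.sum_const, Finset.card_univ,
      Nat.card_eq_fintype_card, nsmul_eq_mul]
  let e := Equiv.sigmaFiberEquiv (fun I : Ideal (𝓞 K) ↦ Ideal.absNorm I)
  have hsig : Summable (fun x : (Σ n, {I : Ideal (𝓞 K) // Ideal.absNorm I = n}) ↦
      (Ideal.absNorm x.2.1 : ℝ) ^ (-s)) := by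
    rw [summable_sigma_of_nonneg (fun _ ↦ by positivity)]
    exact ⟨fun n ↦ (hfib n).summable, by simpa only [(hfib _).tsum_eq] using hsum⟩
  refine ⟨e.summable_iff.mp hsig, ?_⟩
  rw [hζ, ← e.tsum_eq]
  congr 1
  rw [← tsum_congr fun n ↦ (hfib n).tsum_eq]
  exact (hsig.tsum_sigma' fun n ↦ (hfib n).summable).symm

theorem prod_one_add_absNorm_rpow_le_tsum {s : ℝ}
    (hs : Summable (fun I : Ideal (𝓞 K) ↦ (Ideal.absNorm I : ℝ) ^ (-s)))
    (S : Finset (HeightOneSpectrum (𝓞 K))) :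
    ∏ P ∈ S, (1 + (Ideal.absNorm P.asIdeal : ℝ) ^ (-s)) ≤
      ∑' I : Ideal (𝓞 K), (Ideal.absNorm I : ℝ) ^ (-s) := by
  classical
  rw [Finset.prod_one_add]
  have hinj : Set.InjOn (fun T : Finset (HeightOneSpectrum (𝓞 K)) ↦ ∏ P ∈ T, P.asIdeal)
      (S.powerset : Set _) := by
    intro T _ T' _ h
    have key : ∀ T : Finset (HeightOneSpectrum (𝓞 K)), ∀ P : HeightOneSpectrum (𝓞 K),
        P ∈ T ↔ P.asIdeal ∣ ∏ Q ∈ T, Q.asIdeal := by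
      intro T P
      refine ⟨fun hP ↦ Finset.dvd_prod_of_mem _ hP, fun h ↦ ?_⟩
      obtain ⟨Q, hQ, hd⟩ := (P.prime.dvd_finsetProd_iff _).mp h
      have : P.asIdeal = Q.asIdeal :=
        associated_iff_eq.mp ((P.prime.dvd_prime_iff_associated Q.prime).mp hd)
      rwa [HeightOneSpectrum.ext this]
    ext P
    rw [key, key]
    simp only at h
    rw [h]
  calc _ = ∑ T ∈ S.powerset, (Ideal.absNorm (∏ P ∈ T, P.asIdeal) : ℝ) ^ (-s) := by
        refine Finset.sum_congr rfl fun T _ ↦ ?_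
        rw [map_prod, Nat.cast_prod, Real.finsetProd_rpow _ _ (fun _ _ ↦ by positivity)]
    _ = ∑ I ∈ S.powerset.image (fun T ↦ ∏ P ∈ T, P.asIdeal), (Ideal.absNorm I : ℝ) ^ (-s) := by
        rw [Finset.sum_image hinj]
    _ ≤ _ := hs.sum_le_tsum _ (fun _ _ ↦ by positivity)

theorem exists_eq_prod_mul_sq (I : Ideal (𝓞 K)) (hI : I ≠ ⊥) :
    ∃ (T : Finset (HeightOneSpectrum (𝓞 K))) (B : Ideal (𝓞 K)),
      I = (∏ P ∈ T, P.asIdeal) * B ^ 2 := by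
  classical
  induction I using UniqueFactorizationMonoid.induction_on_prime with
  | h₁ => exact absurd rfl hI
  | h₂ I hu => exact ⟨∅, I, by rw [Ideal.isUnit_iff.mp hu]; simp [← Ideal.one_eq_top]⟩
  | h₃ I P hI0 hP ih =>
    obtain ⟨T, B, rfl⟩ := ih hI0
    let Q : HeightOneSpectrum (𝓞 K) := ⟨P, Ideal.isPrime_of_prime hP, hP.ne_zero⟩
    by_cases hQ : Q ∈ T
    · refine ⟨T.erase Q, P * B, ?_⟩
      rw [← Finset.mul_prod_erase T _ hQ]
      change P * (P * _ * _) = _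
      ring
    · refine ⟨insert Q T, B, ?_⟩
      rw [Finset.prod_insert hQ, mul_assoc]

theorem tsum_absNorm_rpow_le {s : ℝ} (h0 : 0 < s)
    (hs : Summable (fun I : Ideal (𝓞 K) ↦ (Ideal.absNorm I : ℝ) ^ (-s)))
    (hs2 : Summable (fun I : Ideal (𝓞 K) ↦ (Ideal.absNorm I : ℝ) ^ (-(2 * s))))
    (hP : Summable (fun P : HeightOneSpectrum (𝓞 K) ↦ (Ideal.absNorm P.asIdeal : ℝ) ^ (-s))) :
    ∑' I : Ideal (𝓞 K), (Ideal.absNorm I : ℝ) ^ (-s) ≤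
      Real.exp (∑' P : HeightOneSpectrum (𝓞 K), (Ideal.absNorm P.asIdeal : ℝ) ^ (-s)) *
        ∑' I : Ideal (𝓞 K), (Ideal.absNorm I : ℝ) ^ (-(2 * s)) := by
  classical
  refine hs.tsum_le_of_sum_le fun F ↦ ?_
  choose! T B hTB using exists_eq_prod_mul_sq K
  set F' := F.filter (· ≠ ⊥) with hF'
  have h1 : ∑ I ∈ F, (Ideal.absNorm I : ℝ) ^ (-s) = ∑ I ∈ F', (Ideal.absNorm I : ℝ) ^ (-s) := by
    rw [hF', Finset.sum_filter]
    refine Finset.sum_congr rfl fun I _ ↦ ?_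
    split_ifs with h
    · rfl
    · rw [not_not.mp h]; simp [Real.zero_rpow (neg_ne_zero.mpr h0.ne')]
  set S := F'.biUnion T
  set G := F'.image B
  have hinj : Set.InjOn (fun I ↦ (T I, B I)) (F' : Set (Ideal (𝓞 K))) := by
    intro I hI J hJ h
    simp only [Prod.mk.injEq] at h
    rw [hTB I (Finset.mem_filter.mp hI).2, hTB J (Finset.mem_filter.mp hJ).2, h.1, h.2]
  rw [h1]
  calc ∑ I ∈ F', (Ideal.absNorm I : ℝ) ^ (-s)
      = ∑ I ∈ F', (∏ P ∈ T I, (Ideal.absNorm P.asIdeal : ℝ) ^ (-s)) *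
          (Ideal.absNorm (B I) : ℝ) ^ (-(2 * s)) := by
        refine Finset.sum_congr rfl fun I hI ↦ ?_
        conv_lhs => rw [hTB I (Finset.mem_filter.mp hI).2]
        rw [map_mul, map_prod, map_pow, Nat.cast_mul, Nat.cast_prod, Nat.cast_pow,
          Real.mul_rpow (by positivity) (by positivity),
          Real.finsetProd_rpow _ _ (fun _ _ ↦ by positivity), ← Real.rpow_natCast_mul (by positivity)]
        congr 2
        push_cast; ring
    _ = ∑ x ∈ F'.image (fun I ↦ (T I, B I)), (∏ P ∈ x.1, (Ideal.absNorm P.asIdeal : ℝ) ^ (-s)) *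
          (Ideal.absNorm x.2 : ℝ) ^ (-(2 * s)) := by rw [Finset.sum_image hinj]
    _ ≤ ∑ x ∈ S.powerset ×ˢ G, (∏ P ∈ x.1, (Ideal.absNorm P.asIdeal : ℝ) ^ (-s)) *
          (Ideal.absNorm x.2 : ℝ) ^ (-(2 * s)) := by
        refine Finset.sum_le_sum_of_subset_of_nonneg ?_ (fun _ _ _ ↦ by positivity)
        intro x hx
        obtain ⟨I, hI, rfl⟩ := Finset.mem_image.mp hx
        exact Finset.mem_product.mpr ⟨Finset.mem_powerset.mpr (Finset.subset_biUnion_of_mem T hI),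
          Finset.mem_image_of_mem _ hI⟩
    _ = (∏ P ∈ S, (1 + (Ideal.absNorm P.asIdeal : ℝ) ^ (-s))) *
          ∑ J ∈ G, (Ideal.absNorm J : ℝ) ^ (-(2 * s)) := by
        rw [Finset.sum_product, Finset.prod_one_add, Finset.sum_mul_sum]
    _ ≤ _ := by
        gcongr
        · calc _ ≤ ∏ P ∈ S, Real.exp ((Ideal.absNorm P.asIdeal : ℝ) ^ (-s)) := by
                refine Finset.prod_le_prod (fun _ _ ↦ by positivity) fun P _ ↦ ?_
                rw [add_comm]; exact Real.add_one_le_exp _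
            _ = Real.exp (∑ P ∈ S, (Ideal.absNorm P.asIdeal : ℝ) ^ (-s)) := (Real.exp_sum _ _).symm
            _ ≤ _ := Real.exp_le_exp.mpr (hP.sum_le_tsum _ (fun _ _ ↦ by positivity))
        · exact hs2.sum_le_tsum _ (fun _ _ ↦ by positivity)

theorem abs_tsum_primes_sub_log_le :
    ∃ C : ℝ, ∀ᶠ s : ℝ in 𝓝[>] 1,
      Summable (fun P : HeightOneSpectrum (𝓞 K) ↦ (Ideal.absNorm P.asIdeal : ℝ) ^ (-s)) ∧
      |∑' P : HeightOneSpectrum (𝓞 K), (Ideal.absNorm P.asIdeal : ℝ) ^ (-s) -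
        Real.log (1 / (s - 1))| ≤ C := by
  obtain ⟨s₀, ⟨hs₀, -⟩, h1s₀, hs₀2⟩ :=
    ((eventually_summable_absNorm_rpow K).and (Ioo_mem_nhdsGT one_lt_two)).exists
  set Z : ℝ → ℝ := fun s ↦ ∑' I : Ideal (𝓞 K), (Ideal.absNorm I : ℝ) ^ (-s) with hZ
  have hinj : Function.Injective (fun P : HeightOneSpectrum (𝓞 K) ↦ P.asIdeal) :=
    fun P Q h ↦ HeightOneSpectrum.ext h
  have hmono : ∀ {s : ℝ}, 1 < s → ∀ I : Ideal (𝓞 K),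
      (Ideal.absNorm I : ℝ) ^ (-(2 * s)) ≤ (Ideal.absNorm I : ℝ) ^ (-s₀) := by
    intro s hs I
    rcases Nat.eq_zero_or_pos (Ideal.absNorm I) with h | h
    · rw [h, Nat.cast_zero, Real.zero_rpow (by linarith), Real.zero_rpow (by linarith)]
    · exact Real.rpow_le_rpow_of_exponent_le (by exact_mod_cast h) (by linarith)
  have hZpos : ∀ {s : ℝ}, Summable (fun I : Ideal (𝓞 K) ↦ (Ideal.absNorm I : ℝ) ^ (-s)) →
      0 < Z s := by
    intro s hs
    have := hs.le_tsum ⊤ (fun _ _ ↦ by positivity)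
    simp only [Ideal.absNorm_top, Nat.cast_one, Real.one_rpow] at this
    exact zero_lt_one.trans_le this
  have hres := dedekindZeta_residue_pos K
  have hlim : Tendsto (fun s : ℝ ↦ Real.log ((s - 1) * Z s)) (𝓝[>] 1)
      (𝓝 (Real.log (dedekindZeta_residue K))) := by
    refine Tendsto.log ?_ hres.ne'
    have h := (Complex.continuous_re.tendsto _).comp (tendsto_sub_one_mul_dedekindZeta_nhdsGT K)
    rw [Complex.ofReal_re] at h
    refine h.congr' ?_
    filter_upwards [eventually_summable_absNorm_rpow K] with s hs
    rw [Function.comp_apply, hs.2, ← Complex.ofReal_one, ← Complex.ofReal_sub,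
      ← Complex.ofReal_mul, Complex.ofReal_re]
  have hlog : ∀ᶠ s : ℝ in 𝓝[>] 1,
      |Real.log ((s - 1) * Z s)| < |Real.log (dedekindZeta_residue K)| + 1 :=
    hlim.abs.eventually_lt_const (lt_add_one _)
  refine ⟨|Real.log (dedekindZeta_residue K)| + 1 + (Z s₀ + |Real.log (Z s₀)|), ?_⟩
  filter_upwards [eventually_summable_absNorm_rpow K, hlog, self_mem_nhdsWithin]
    with s hsZ hls h1s
  have hs := hsZ.1
  have h1s' : 1 < s := h1s
  have hP : Summable (fun P : HeightOneSpectrum (𝓞 K) ↦ (Ideal.absNorm P.asIdeal : ℝ) ^ (-s)) :=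
    hs.comp_injective hinj
  have hs2 : Summable (fun I : Ideal (𝓞 K) ↦ (Ideal.absNorm I : ℝ) ^ (-(2 * s))) :=
    hs₀.of_nonneg_of_le (fun _ ↦ by positivity) (hmono h1s')
  refine ⟨hP, ?_⟩
  have hupper : Real.log (Z s) ≤
      ∑' P : HeightOneSpectrum (𝓞 K), (Ideal.absNorm P.asIdeal : ℝ) ^ (-s) + Real.log (Z s₀) := by
    rw [← Real.log_exp (∑' P : HeightOneSpectrum (𝓞 K), (Ideal.absNorm P.asIdeal : ℝ) ^ (-s)),
      ← Real.log_mul (Real.exp_ne_zero _) (hZpos hs₀).ne']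
    refine Real.log_le_log (hZpos hs) ((tsum_absNorm_rpow_le K (by linarith) hs hs2 hP).trans ?_)
    gcongr
    exact hs2.tsum_le_tsum (hmono h1s') hs₀
  have hlower : ∑' P : HeightOneSpectrum (𝓞 K), (Ideal.absNorm P.asIdeal : ℝ) ^ (-s) ≤
      Real.log (Z s) + Z s₀ := by
    refine hP.tsum_le_of_sum_le fun S ↦ ?_
    have h1 : ∑ P ∈ S, Real.log (1 + (Ideal.absNorm P.asIdeal : ℝ) ^ (-s)) ≤ Real.log (Z s) := by
      rw [← Real.log_prod (fun P _ ↦ by positivity)]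
      exact Real.log_le_log (Finset.prod_pos fun _ _ ↦ by positivity)
        (prod_one_add_absNorm_rpow_le_tsum K hs S)
    have h2 : ∑ P ∈ S, (Ideal.absNorm P.asIdeal : ℝ) ^ (-(2 * s)) ≤ Z s₀ :=
      calc _ ≤ ∑ P ∈ S, (Ideal.absNorm P.asIdeal : ℝ) ^ (-s₀) :=
            Finset.sum_le_sum fun P _ ↦ hmono h1s' _
        _ ≤ ∑' P : HeightOneSpectrum (𝓞 K), (Ideal.absNorm P.asIdeal : ℝ) ^ (-s₀) :=
            (hs₀.comp_injective hinj).sum_le_tsum _ (fun _ _ ↦ by positivity)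
        _ ≤ Z s₀ := tsum_comp_le_tsum_of_inj hs₀ (fun _ ↦ by positivity) hinj
    have h3 : ∀ x : ℝ, 0 ≤ x → x ≤ Real.log (1 + x) + x ^ 2 := by
      intro x hx
      have h := Real.one_sub_inv_le_log_of_pos (show 0 < 1 + x by positivity)
      have : x - x ^ 2 ≤ 1 - (1 + x)⁻¹ := by
        have h5 : 0 < 1 + x := by positivity
        rw [← sub_nonneg]
        have : 1 - (1 + x)⁻¹ - (x - x ^ 2) = x ^ 3 / (1 + x) := by field_simp; ring
        rw [this]; positivity
      linarith
    calc _ ≤ ∑ P ∈ S, (Real.log (1 + (Ideal.absNorm P.asIdeal : ℝ) ^ (-s)) +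
            (Ideal.absNorm P.asIdeal : ℝ) ^ (-(2 * s))) := by
          refine Finset.sum_le_sum fun P _ ↦ ?_
          have h := h3 ((Ideal.absNorm P.asIdeal : ℝ) ^ (-s)) (by positivity)
          rwa [← Real.rpow_mul_natCast (by positivity), Nat.cast_two,
            show -s * 2 = -(2 * s) by ring] at h
      _ ≤ _ := by rw [Finset.sum_add_distrib]; linarith
  rw [Real.log_mul (by linarith) (hZpos hs).ne'] at hls
  rw [one_div, Real.log_inv]
  have h4 := le_abs_self (Real.log (Z s₀))
  have h5 := (hZpos hs₀)
  have h6 := abs_lt.mp hls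
  have h7 := abs_nonneg (Real.log (Z s₀))
  rw [abs_le]
  constructor <;> linarith [h6.1, h6.2]

end

/-- The number of roots of `f` modulo `r`. -/
noncomputable def rootCount (f : ℤ[X]) (r : ℕ) : ℕ :=
  Nat.card {x : ZMod r // (f.map (Int.castRingHom (ZMod r))).IsRoot x}

section
variable {K : Type*} [Field K] [NumberField K]

theorem exponent_ne_zero_of_powerBasis {θ : 𝓞 K} (B : PowerBasis ℚ K) (h : B.gen = (θ : K)) :
    RingOfIntegers.exponent θ ≠ 0 := by
  have hint : IsIntegral ℤ B.gen := h ▸ RingOfIntegers.isIntegral_coe θ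
  have hd : IsIntegral ℤ (Algebra.discr ℚ B.basis) := by
    refine Algebra.discr_isIntegral ℚ fun i ↦ ?_
    rw [B.basis_eq_pow]
    exact hint.pow _
  obtain ⟨d, hd⟩ := IsIntegrallyClosed.isIntegral_iff.mp hd
  have hd0 : d ≠ 0 := by
    rintro rfl
    rw [map_zero] at hd
    exact (Algebra.discr_not_zero_of_basis ℚ B.basis) hd.symm
  have hmem : (d : 𝓞 K) ∈ conductor ℤ θ := by
    rw [mem_conductor_iff]
    intro b
    have h1 := Algebra.discr_mul_isIntegral_mem_adjoin (R := ℤ) (K := ℚ) hint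
      (RingOfIntegers.isIntegral_coe b)
    rw [← hd, h, algebraMap_smul] at h1
    rw [Algebra.adjoin_singleton_eq_range_aeval] at h1 ⊢
    obtain ⟨g, hg⟩ := h1
    refine ⟨g, RingOfIntegers.coe_injective ?_⟩
    have : ((aeval θ g : 𝓞 K) : K) = aeval (θ : K) g := by
      exact (aeval_algebraMap_apply K θ g).symm
    change ((aeval θ g : 𝓞 K) : K) = _
    rw [this]
    refine hg.trans ?_
    simp [zsmul_eq_mul]
  rw [RingOfIntegers.exponent, Ne, Ideal.absNorm_eq_zero_iff, Submodule.eq_bot_iff]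
  push Not
  exact ⟨d, by simpa [Ideal.under, Ideal.mem_comap] using hmem, hd0⟩

theorem card_primesOver_absNorm_eq {θ : 𝓞 K} {r : ℕ} [hr : Fact r.Prime]
    (hθ : ¬ r ∣ RingOfIntegers.exponent θ) :
    Nat.card {P : Ideal.primesOver (Ideal.span {(r : ℤ)}) (𝓞 K) // Ideal.absNorm P.1 = r} =
      rootCount (minpoly ℤ θ) r := by
  set g := (minpoly ℤ θ).map (Int.castRingHom (ZMod r)) with hg
  have hg0 : g ≠ 0 := map_monic_ne_zero (minpoly.monic θ.isIntegral)
  let e := NumberField.Ideal.primesOverSpanEquivMonicFactorsMod hθ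
  have hdeg : ∀ P : Ideal.primesOver (Ideal.span {(r : ℤ)}) (𝓞 K),
      Ideal.absNorm P.1 = r ↔ (e P : (ZMod r)[X]).natDegree = 1 := by
    intro P
    have h1 := NumberField.Ideal.inertiaDeg_primesOverSpanEquivMonicFactorsMod_symm_apply' hθ
      (e P).2
    rw [Subtype.coe_eta, Equiv.symm_apply_apply] at h1
    have := P.2.1
    have := P.2.2
    rw [← h1, ← Ideal.pow_inertiaDeg r P.1]
    exact Nat.pow_eq_self_iff hr.out.one_lt
  have hmem : ∀ x : {x : ZMod r // g.IsRoot x},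
      X - C x.1 ∈ RingOfIntegers.monicFactorsMod θ r := by
    intro x
    rw [Multiset.mem_toFinset, Polynomial.mem_normalizedFactors_iff hg0]
    exact ⟨irreducible_X_sub_C _, monic_X_sub_C _, dvd_iff_isRoot.mpr x.2⟩
  let φ : {x : ZMod r // g.IsRoot x} →
      {Q : RingOfIntegers.monicFactorsMod θ r // (Q : (ZMod r)[X]).natDegree = 1} :=
    fun x ↦ ⟨⟨X - C x.1, hmem x⟩, natDegree_X_sub_C x.1⟩
  refine Nat.card_congr ((e.subtypeEquiv hdeg).trans (Equiv.ofBijective φ ⟨?_, ?_⟩).symm)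
  · intro x y hxy
    simp only [φ, Subtype.mk.injEq, sub_right_inj, C_inj] at hxy
    exact Subtype.ext hxy
  · rintro ⟨⟨Q, hQ⟩, hQ1⟩
    rw [Multiset.mem_toFinset, Polynomial.mem_normalizedFactors_iff hg0] at hQ
    have hQ2 : Q = X - C (-Q.coeff 0) := by
      rw [C_neg, sub_neg_eq_add]
      exact hQ.2.1.eq_X_add_C hQ1
    refine ⟨⟨-Q.coeff 0, dvd_iff_isRoot.mp ?_⟩, ?_⟩
    · rw [← hQ2]; exact hQ.2.2
    · exact Subtype.ext (Subtype.ext hQ2.symm)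

end

theorem rootCount_le_natDegree {f : ℤ[X]} (hf : f.Monic) {r : ℕ} (hr : r.Prime) :
    rootCount f r ≤ f.natDegree := by
  have := Fact.mk hr
  set g := f.map (Int.castRingHom (ZMod r)) with hg
  have hg0 : g ≠ 0 := map_monic_ne_zero hf
  have h1 : rootCount f r = g.roots.toFinset.card := by
    rw [rootCount, ← Nat.card_eq_finsetCard]
    refine Nat.card_congr (Equiv.subtypeEquivRight fun x ↦ ?_)
    rw [Multiset.mem_toFinset, mem_roots hg0]
  rw [h1]
  exact (Multiset.toFinset_card_le _).trans ((card_roots' _).trans natDegree_map_le)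

section
variable {K : Type*} [Field K] [NumberField K]

theorem card_primesOver_le_finrank {r : ℕ} (hr : r.Prime)
    [Fintype (Ideal.primesOver (Ideal.span {(r : ℤ)}) (𝓞 K))] :
    Fintype.card (Ideal.primesOver (Ideal.span {(r : ℤ)}) (𝓞 K)) ≤ Module.finrank ℤ (𝓞 K) := by
  have : (Ideal.span {(r : ℤ)}).IsPrime :=
    (Ideal.span_singleton_prime (by exact_mod_cast hr.ne_zero)).mpr (Nat.prime_iff_prime_int.mp hr)
  rw [← Ideal.sum_ramification_inertia_eq_finrank (Ideal.span {(r : ℤ)}) (𝓞 K), Fintype.card,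
    Finset.card_eq_sum_ones]
  refine Finset.sum_le_sum fun P _ ↦ ?_
  have := P.2.1
  exact Nat.mul_pos (Ideal.ramificationIdx_pos _ _) (Ideal.inertiaDeg_pos _ _)

theorem abs_sum_primesOver_sub_rootCount_le (θ : 𝓞 K) {r : ℕ} (hr : r.Prime)
    [Fintype (Ideal.primesOver (Ideal.span {(r : ℤ)}) (𝓞 K))] {s : ℝ} (hs : 1 < s) :
    |∑ P : Ideal.primesOver (Ideal.span {(r : ℤ)}) (𝓞 K), (Ideal.absNorm P.1 : ℝ) ^ (-s) -
      rootCount (minpoly ℤ θ) r * (r : ℝ) ^ (-s)| ≤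
      Module.finrank ℤ (𝓞 K) * (r : ℝ) ^ (-2 : ℝ) + if r ∣ RingOfIntegers.exponent θ then
        (Module.finrank ℤ (𝓞 K) + rootCount (minpoly ℤ θ) r : ℝ) else 0 := by
  have hr1 : (1 : ℝ) < r := by exact_mod_cast hr.one_lt
  have hcard : (Fintype.card (Ideal.primesOver (Ideal.span {(r : ℤ)}) (𝓞 K)) : ℝ) ≤
      Module.finrank ℤ (𝓞 K) := by exact_mod_cast card_primesOver_le_finrank hr
  have hnorm : ∀ P : Ideal.primesOver (Ideal.span {(r : ℤ)}) (𝓞 K),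
      ∃ d : ℕ, 0 < d ∧ Ideal.absNorm P.1 = r ^ d := by
    intro P
    have := P.2.1
    have := P.2.2
    exact ⟨P.1.inertiaDeg ℤ, Ideal.inertiaDeg_pos _ _, (Ideal.pow_inertiaDeg r P.1).symm⟩
  split_ifs with h
  · have h1 : ∑ P : Ideal.primesOver (Ideal.span {(r : ℤ)}) (𝓞 K), (Ideal.absNorm P.1 : ℝ) ^ (-s)
        ≤ Module.finrank ℤ (𝓞 K) := by
      refine le_trans ?_ hcard
      rw [Fintype.card, Finset.card_eq_sum_ones, Nat.cast_sum]
      refine Finset.sum_le_sum fun P _ ↦ ?_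
      obtain ⟨d, hd, hP⟩ := hnorm P
      rw [hP, Nat.cast_one]
      refine Real.rpow_le_one_of_one_le_of_nonpos ?_ (by linarith)
      exact_mod_cast Nat.one_le_pow _ _ hr.pos
    have h2 : (r : ℝ) ^ (-s) ≤ 1 := Real.rpow_le_one_of_one_le_of_nonpos hr1.le (by linarith)
    have h3 : 0 ≤ ∑ P : Ideal.primesOver (Ideal.span {(r : ℤ)}) (𝓞 K),
      (Ideal.absNorm P.1 : ℝ) ^ (-s) := Finset.sum_nonneg fun _ _ ↦ by positivity
    have h4 : 0 ≤ (Module.finrank ℤ (𝓞 K) : ℝ) * (r : ℝ) ^ (-2 : ℝ) := by positivity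
    have h5 : (rootCount (minpoly ℤ θ) r : ℝ) * (r : ℝ) ^ (-s) ≤ rootCount (minpoly ℤ θ) r :=
      mul_le_of_le_one_right (by positivity) h2
    have h6 : 0 ≤ (rootCount (minpoly ℤ θ) r : ℝ) * (r : ℝ) ^ (-s) := by positivity
    rw [abs_le]
    constructor <;> linarith
  · have := Fact.mk hr
    have h1 : (rootCount (minpoly ℤ θ) r : ℝ) * (r : ℝ) ^ (-s) =
        ∑ P : Ideal.primesOver (Ideal.span {(r : ℤ)}) (𝓞 K),
          if Ideal.absNorm P.1 = r then (r : ℝ) ^ (-s) else 0 := by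
      rw [← card_primesOver_absNorm_eq h, ← Finset.sum_filter, Finset.sum_const, nsmul_eq_mul,
        Nat.card_eq_fintype_card, Fintype.card_subtype]
    rw [h1, ← Finset.sum_sub_distrib, add_zero]
    refine (Finset.abs_sum_le_sum_abs _ _).trans ?_
    refine (Finset.sum_le_card_nsmul _ _ ((r : ℝ) ^ (-2 : ℝ)) fun P _ ↦ ?_).trans ?_
    · split_ifs with hP
      · rw [hP, sub_self, abs_zero]; positivity
      · obtain ⟨d, hd, hP'⟩ := hnorm P
        have hd2 : 2 ≤ d := by
          rcases Nat.lt_or_ge d 2 with h2 | h2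
          · exact absurd (by rw [hP', show d = 1 by omega, pow_one]) hP
          · exact h2
        rw [sub_zero, abs_of_nonneg (by positivity), hP', Nat.cast_pow, ← Real.rpow_natCast,
          ← Real.rpow_mul (by positivity)]
        refine Real.rpow_le_rpow_of_exponent_le hr1.le ?_
        have : (2 : ℝ) ≤ d := by exact_mod_cast hd2
        nlinarith
    · rw [nsmul_eq_mul]
      exact mul_le_mul_of_nonneg_right hcard (by positivity)

variable (K) in
/-- A nonzero prime ideal corresponds to a rational prime and a prime ideal above it. -/
noncomputable def sigmaPrimesOverEquiv :
    (Σ r : Nat.Primes, Ideal.primesOver (Ideal.span {((r : ℕ) : ℤ)}) (𝓞 K)) ≃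
      HeightOneSpectrum (𝓞 K) :=
  Equiv.ofBijective (fun x ↦ ⟨x.2.1, x.2.2.1, by
      have := x.2.2.2
      refine Ideal.ne_bot_of_liesOver_of_ne_bot (p := Ideal.span {((x.1 : ℕ) : ℤ)}) ?_ x.2.1
      rw [Ne, Ideal.span_singleton_eq_bot]
      exact_mod_cast x.1.2.ne_zero⟩) (by
    constructor
    · rintro ⟨r, P, hP1, hP2⟩ ⟨t, Q, hQ1, hQ2⟩ h
      obtain rfl : P = Q := congrArg HeightOneSpectrum.asIdeal h
      have h1 : Ideal.span {((r : ℕ) : ℤ)} = Ideal.span {((t : ℕ) : ℤ)} := hP2.over.trans hQ2.over.symm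
      have h2 : r = t := by
        rw [Ideal.span_singleton_eq_span_singleton, Int.associated_iff_natAbs] at h1
        exact Subtype.ext (by simpa using h1)
      subst h2
      rfl
    · intro P
      have := P.isPrime
      have : NeZero P.asIdeal := ⟨P.ne_bot⟩
      exact ⟨⟨⟨_, Nat.absNorm_under_prime P.asIdeal⟩, P.asIdeal, P.isPrime,
        Int.liesOver_span_absNorm _⟩, rfl⟩)

theorem abs_tsum_primes_sub_tsum_rootCount_le (θ : 𝓞 K) (hθ : RingOfIntegers.exponent θ ≠ 0) :
    ∃ C : ℝ, ∀ s : ℝ, 1 < s →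
      Summable (fun P : HeightOneSpectrum (𝓞 K) ↦ (Ideal.absNorm P.asIdeal : ℝ) ^ (-s)) →
      Summable (fun r : Nat.Primes ↦ (rootCount (minpoly ℤ θ) r : ℝ) * (r : ℝ) ^ (-s)) ∧
      |∑' P : HeightOneSpectrum (𝓞 K), (Ideal.absNorm P.asIdeal : ℝ) ^ (-s) -
        ∑' r : Nat.Primes, (rootCount (minpoly ℤ θ) r : ℝ) * (r : ℝ) ^ (-s)| ≤ C := by
  have hfin : ∀ r : Nat.Primes, Finite (Ideal.primesOver (Ideal.span {((r : ℕ) : ℤ)}) (𝓞 K)) := by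
    intro r
    have : (Ideal.span {((r : ℕ) : ℤ)}).IsPrime :=
      (Ideal.span_singleton_prime (by exact_mod_cast r.2.ne_zero)).mpr
        (Nat.prime_iff_prime_int.mp r.2)
    exact Algebra.QuasiFinite.finite_primesOver _
  have := fun r ↦ Fintype.ofFinite (Ideal.primesOver (Ideal.span {(((r : Nat.Primes) : ℕ) : ℤ)}) (𝓞 K))
  set b : Nat.Primes → ℝ := fun r ↦ Module.finrank ℤ (𝓞 K) * (r : ℝ) ^ (-2 : ℝ) +
    if (r : ℕ) ∣ RingOfIntegers.exponent θ then
      (Module.finrank ℤ (𝓞 K) + rootCount (minpoly ℤ θ) r : ℝ) else 0 with hb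
  have hbs : Summable b := by
    refine Summable.add ((Nat.Primes.summable_rpow.mpr (by norm_num)).mul_left _) ?_
    refine summable_of_hasFiniteSupport (Set.Finite.subset (s := (fun r : Nat.Primes ↦ (r : ℕ)) ⁻¹'
      (RingOfIntegers.exponent θ).divisors) ?_ ?_)
    · exact (Finset.finite_toSet _).preimage Subtype.val_injective.injOn
    · intro r hr
      simp only [Function.mem_support, ne_eq, ite_eq_right_iff, Classical.not_imp] at hr
      simpa using ⟨hr.1, hθ⟩
  refine ⟨∑' r, b r, fun s hs hsum ↦ ?_⟩
  have hsum' := (sigmaPrimesOverEquiv K).summable_iff.mpr hsum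
  have htsum := (sigmaPrimesOverEquiv K).tsum_eq
    (fun P : HeightOneSpectrum (𝓞 K) ↦ (Ideal.absNorm P.asIdeal : ℝ) ^ (-s))
  have hsig := hsum'.sigma
  rw [← htsum]
  have h2 := hsum'.tsum_sigma
  simp only [Function.comp_apply, tsum_fintype] at h2 hsig
  have hbound : ∀ r : Nat.Primes, ‖∑ P : Ideal.primesOver (Ideal.span {((r : ℕ) : ℤ)}) (𝓞 K),
      (Ideal.absNorm P.1 : ℝ) ^ (-s) - rootCount (minpoly ℤ θ) r * (r : ℝ) ^ (-s)‖ ≤ b r :=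
    fun r ↦ abs_sum_primesOver_sub_rootCount_le θ r.2 hs
  have hdiff := Summable.of_norm_bounded hbs hbound
  have hroot : Summable (fun r : Nat.Primes ↦ (rootCount (minpoly ℤ θ) r : ℝ) * (r : ℝ) ^ (-s)) := by
    refine (hsig.sub hdiff).congr fun r ↦ ?_
    exact sub_sub_cancel _ _
  refine ⟨hroot, ?_⟩
  rw [h2]
  rw [← hsig.tsum_sub hroot]
  exact tsum_of_norm_bounded hbs.hasSum hbound

end

theorem abs_tsum_rootCount_sub_log_le {f : ℤ[X]} (hm : f.Monic) (hf : Irreducible f) :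
    ∃ C : ℝ, ∀ᶠ s : ℝ in 𝓝[>] 1,
      Summable (fun r : Nat.Primes ↦ (rootCount f r : ℝ) * (r : ℝ) ^ (-s)) ∧
      |∑' r : Nat.Primes, (rootCount f r : ℝ) * (r : ℝ) ^ (-s) - Real.log (1 / (s - 1))| ≤ C := by
  set g := f.map (Int.castRingHom ℚ) with hg
  have hgm : g.Monic := hm.map _
  have hgi : Irreducible g := (hm.irreducible_iff_irreducible_map_fraction_map (K := ℚ)).mp hf
  have := Fact.mk hgi
  have hroot : aeval (AdjoinRoot.root g) f = 0 := by
    rw [← aeval_map_algebraMap ℚ (AdjoinRoot.root g) f]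
    exact AdjoinRoot.aeval_eq g ▸ AdjoinRoot.mk_self
  let θ : 𝓞 (AdjoinRoot g) := ⟨AdjoinRoot.root g, f, hm, hroot⟩
  have hθ : minpoly ℤ θ = f := by
    refine eq_of_monic_of_associated (minpoly.monic θ.isIntegral) hm ?_
    rw [← (minpoly.irreducible θ.isIntegral).dvd_irreducible_iff_associated hf]
    exact minpoly.isIntegrallyClosed_dvd θ.isIntegral (RingOfIntegers.coe_injective
      ((aeval_algebraMap_apply (AdjoinRoot g) θ f).symm.trans hroot))
  obtain ⟨C₁, h₁⟩ := abs_tsum_primes_sub_log_le (AdjoinRoot g)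
  obtain ⟨C₂, h₂⟩ := abs_tsum_primes_sub_tsum_rootCount_le θ
    (exponent_ne_zero_of_powerBasis (AdjoinRoot.powerBasis hgi.ne_zero) rfl)
  refine ⟨C₁ + C₂, ?_⟩
  filter_upwards [h₁, self_mem_nhdsWithin] with s hs hs1
  obtain ⟨h3, h4⟩ := h₂ s hs1 hs.1
  rw [hθ] at h3 h4
  refine ⟨h3, ?_⟩
  have := hs.2
  rw [abs_le] at *
  constructor <;> linarith [this.1, this.2, h4.1, h4.2]

theorem sum_mul_nonneg_of_antitone {d w : ℕ → ℝ} (hw : Antitone w) (hw0 : ∀ n, 0 ≤ w n)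
    (hd : ∀ N, 0 ≤ ∑ n ∈ Finset.range (N + 1), d n) (N : ℕ) :
    0 ≤ ∑ n ∈ Finset.range N, d n * w n := by
  have key : ∀ N, (∑ n ∈ Finset.range (N + 1), d n) * w N ≤
      ∑ n ∈ Finset.range (N + 1), d n * w n := by
    intro N
    induction N with
    | zero => simp
    | succ N ih =>
      rw [Finset.sum_range_succ, Finset.sum_range_succ (fun n ↦ d n * w n), add_mul]
      gcongr
      exact (mul_le_mul_of_nonneg_left (hw N.le_succ) (hd N)).trans ih
  rcases N with _ | N
  · simp
  · exact (mul_nonneg (hd N) (hw0 N)).trans (key N)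

theorem tsum_primes_le_of_density_zero (B : ℕ → Prop) [DecidablePred B]
    (h : Tendsto (fun N : ℕ ↦
      ((Finset.filter (fun r : ℕ ↦ r.Prime ∧ B r) (Finset.range (N + 1))).card : ℝ) /
        ((Finset.filter Nat.Prime (Finset.range (N + 1))).card : ℝ)) atTop (𝓝 0))
    {ε : ℝ} (hε : 0 < ε) :
    ∃ C : ℝ, ∀ s : ℝ, 1 < s → ∑' r : Nat.Primes, (if B r then (r : ℝ) ^ (-s) else 0) ≤
      ε * ∑' r : Nat.Primes, (r : ℝ) ^ (-s) + C := by
  obtain ⟨N₀, hN₀⟩ := eventually_atTop.mp (h.eventually_lt_const hε)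
  refine ⟨N₀, fun s hs ↦ ?_⟩
  set w : ℕ → ℝ := fun n ↦ ((max n 1 : ℕ) : ℝ) ^ (-s) with hw
  have hwanti : Antitone w := by
    intro m n hmn
    refine Real.rpow_le_rpow_of_nonpos ?_ ?_ (by linarith)
    · exact_mod_cast lt_max_of_lt_right Nat.one_pos
    · exact_mod_cast max_le_max_right 1 hmn
  have hw0 : ∀ n, 0 ≤ w n := fun n ↦ by positivity
  have hw1 : ∀ n, w n ≤ 1 := fun n ↦
    Real.rpow_le_one_of_one_le_of_nonpos (by exact_mod_cast le_max_right n 1) (by linarith)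
  have hwp : ∀ n : ℕ, n.Prime → w n = (n : ℝ) ^ (-s) := fun n hn ↦ by
    rw [hw]; simp only; rw [max_eq_left hn.one_le]
  have hcount : ∀ N, ((Finset.filter (fun r : ℕ ↦ r.Prime ∧ B r) (Finset.range (N + 1))).card : ℝ) ≤
      ε * (Finset.filter Nat.Prime (Finset.range (N + 1))).card + N₀ := by
    intro N
    rcases le_total N₀ N with hN | hN
    · have h1 := hN₀ N hN
      rcases Nat.eq_zero_or_pos (Finset.filter Nat.Prime (Finset.range (N + 1))).card with h0 | h0
      · have : (Finset.filter (fun r : ℕ ↦ r.Prime ∧ B r) (Finset.range (N + 1))).card = 0 := by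
          refine Nat.eq_zero_of_le_zero (h0 ▸ Finset.card_le_card ?_)
          exact Finset.monotone_filter_right _ fun _ _ hr ↦ hr.1
        rw [this, h0]; simp
      · rw [div_lt_iff₀ (by exact_mod_cast h0)] at h1
        have : (0 : ℝ) ≤ N₀ := by positivity
        linarith
    · have h1 : (Finset.filter (fun r : ℕ ↦ r.Prime ∧ B r) (Finset.range (N + 1))).card ≤ N := by
        calc _ ≤ (Finset.Icc 1 N).card := Finset.card_le_card fun r hr ↦ by
              rw [Finset.mem_filter, Finset.mem_range] at hr
              exact Finset.mem_Icc.mpr ⟨hr.2.1.one_le, by omega⟩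
          _ = N := by simp
      have h2 : ((Finset.filter (fun r : ℕ ↦ r.Prime ∧ B r) (Finset.range (N + 1))).card : ℝ) ≤ N₀ := by
        exact_mod_cast h1.trans hN
      have : 0 ≤ ε * (Finset.filter Nat.Prime (Finset.range (N + 1))).card := by positivity
      linarith
  have hsum : Summable fun r : Nat.Primes ↦ (r : ℝ) ^ (-s) :=
    Nat.Primes.summable_rpow.mpr (by linarith)
  have hsub := tsum_subtype {r : ℕ | r.Prime} fun r : ℕ ↦ if B r then (r : ℝ) ^ (-s) else 0
  change ∑' r : {r : ℕ | r.Prime}, (if B r then (r : ℝ) ^ (-s) else 0) ≤ _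
  rw [hsub]
  refine Real.tsum_le_of_sum_range_le (fun n ↦ Set.indicator_nonneg (fun _ _ ↦ by positivity) n)
    fun N ↦ ?_
  have h1 := sum_mul_nonneg_of_antitone (d := fun n ↦ (ε * (if n.Prime then 1 else 0) +
    if n = 0 then (N₀ : ℝ) else 0) - if n.Prime ∧ B n then 1 else 0) hwanti hw0 (fun M ↦ by
      rw [Finset.sum_sub_distrib, Finset.sum_add_distrib, ← Finset.mul_sum, Finset.sum_boole,
        Finset.sum_boole, Finset.sum_ite_eq', if_pos (by simp)]
      exact sub_nonneg.mpr (hcount M)) N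
  simp only [sub_mul, add_mul, Finset.sum_sub_distrib, Finset.sum_add_distrib, sub_nonneg] at h1
  calc _ = ∑ n ∈ Finset.range N, (if n.Prime ∧ B n then 1 else 0) * w n := by
        refine Finset.sum_congr rfl fun n _ ↦ ?_
        by_cases hn : n.Prime <;> by_cases hB : B n <;> simp [hn, hB, hwp]
    _ ≤ _ := h1
    _ ≤ _ := by
        gcongr
        · have : ∀ n : ℕ, ε * (if n.Prime then 1 else 0) * w n =
              ε * Set.indicator {r : ℕ | r.Prime} (fun r : ℕ ↦ (r : ℝ) ^ (-s)) n := by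
            intro n
            by_cases hn : n.Prime <;> simp [hn, hwp]
          simp_rw [this, ← Finset.mul_sum]
          gcongr
          change _ ≤ ∑' r : {r : ℕ | r.Prime}, (r : ℝ) ^ (-s)
          rw [tsum_subtype {r : ℕ | r.Prime} fun r : ℕ ↦ (r : ℝ) ^ (-s)]
          refine Summable.sum_le_tsum _ (fun n _ ↦ Set.indicator_nonneg (fun _ _ ↦ by positivity) n) ?_
          exact summable_subtype_iff_indicator.mp hsum
        · refine (Finset.sum_le_sum (g := fun n ↦ if n = 0 then (N₀ : ℝ) else 0) fun n _ ↦ ?_).trans ?_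
          · split_ifs
            · exact mul_le_of_le_one_right (by positivity) (hw1 n)
            · simp
          · rw [Finset.sum_ite_eq']
            split_ifs <;> simp

theorem rootCount_X (r : ℕ) : rootCount X r = 1 := by
  rw [rootCount, Nat.card_eq_one_iff_unique]
  exact ⟨⟨fun x y ↦ Subtype.ext ((by simpa using x.2 : x.1 = 0).trans
    (by simpa using y.2 : y.1 = 0).symm)⟩, ⟨0, by simp⟩⟩

/-- If a linear combination, with positive coefficient sum, of root counts of irreducible
polynomials is nonpositive at almost all primes outside `B`, then `B` does not have density zero. -/
theorem not_density_zero_of_rootCount {ι : Type*} [Fintype ι] {f : ι → ℤ[X]}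
    (hm : ∀ i, (f i).Monic) (hf : ∀ i, Irreducible (f i)) {c : ι → ℝ} (hc : 0 < ∑ i, c i)
    (B : ℕ → Prop) [DecidablePred B] {E : Set ℕ} (hE : E.Finite)
    (hB : ∀ r : ℕ, r.Prime → r ∉ E → ¬ B r → ∑ i, c i * rootCount (f i) r ≤ 0) :
    ¬ Tendsto (fun N : ℕ ↦
      ((Finset.filter (fun r : ℕ ↦ r.Prime ∧ B r) (Finset.range (N + 1))).card : ℝ) /
        ((Finset.filter Nat.Prime (Finset.range (N + 1))).card : ℝ)) atTop (𝓝 0) := by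
  classical
  intro h
  set c₀ := ∑ i, c i with hc₀
  set M : ℝ := 1 + ∑ i, |c i| * (f i).natDegree with hM
  have hM0 : 0 < M := by
    have : 0 ≤ ∑ i, |c i| * ((f i).natDegree : ℝ) := Finset.sum_nonneg fun i _ ↦ by positivity
    linarith
  have hMle : ∀ r : ℕ, r.Prime → ∑ i, c i * rootCount (f i) r ≤ M := by
    intro r hr
    have : ∑ i, c i * (rootCount (f i) r : ℝ) ≤ ∑ i, |c i| * ((f i).natDegree : ℝ) := by
      refine Finset.sum_le_sum fun i _ ↦ ?_
      have h1 : (rootCount (f i) r : ℝ) ≤ (f i).natDegree := by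
        exact_mod_cast rootCount_le_natDegree (hm i) hr
      exact mul_le_mul (le_abs_self _) h1 (by positivity) (by positivity)
    linarith
  obtain ⟨C₀, h₀⟩ := tsum_primes_le_of_density_zero B h (ε := c₀ / (2 * M)) (by positivity)
  choose C hC using fun i ↦ abs_tsum_rootCount_sub_log_le (hm i) (hf i)
  obtain ⟨C₁, hC₁⟩ := abs_tsum_rootCount_sub_log_le monic_X irreducible_X
  have hEs : Summable fun r : Nat.Primes ↦ if (r : ℕ) ∈ E then (1 : ℝ) else 0 := by
    refine summable_of_hasFiniteSupport
      (Set.Finite.subset (hE.preimage Subtype.val_injective.injOn) ?_)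
    intro r hr
    by_contra h
    exact hr (if_neg h)
  set e := ∑' r : Nat.Primes, (if (r : ℕ) ∈ E then (1 : ℝ) else 0) with he
  have hlog : Tendsto (fun s : ℝ ↦ Real.log (1 / (s - 1))) (𝓝[>] 1) atTop := by
    refine Real.tendsto_log_atTop.comp ?_
    simp_rw [one_div]
    refine tendsto_inv_nhdsGT_zero.comp (tendsto_nhdsWithin_iff.mpr ⟨?_, ?_⟩)
    · refine (tendsto_nhdsWithin_of_tendsto_nhds ?_)
      exact (continuous_sub_right (1 : ℝ)).tendsto' _ _ (sub_self 1)
    · filter_upwards [self_mem_nhdsWithin] with s hs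
      exact sub_pos.mpr (Set.mem_Ioi.mp hs)
  obtain ⟨s, hs, hs1, hs2, hs3⟩ := (((eventually_all.mpr hC).and
    ((eventually_mem_nhdsWithin (a := (1 : ℝ)) (s := Set.Ioi 1)).and (hC₁.and (hlog.eventually_gt_atTop ((2 / c₀) *
      (c₀ / 2 * C₁ + M * C₀ + M * e + ∑ i, |c i| * C i)))))).exists)
  replace hs1 : 1 < s := hs1
  set L := Real.log (1 / (s - 1)) with hL
  simp_rw [rootCount_X, Nat.cast_one, one_mul] at hs2
  have hlow : c₀ * L - ∑ i, |c i| * C i ≤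
      ∑' r : Nat.Primes, ∑ i, c i * ((rootCount (f i) r : ℝ) * (r : ℝ) ^ (-s)) := by
    rw [Summable.tsum_finsetSum fun i _ ↦ (hs i).1.mul_left _, hc₀, Finset.sum_mul,
      ← Finset.sum_sub_distrib]
    refine Finset.sum_le_sum fun i _ ↦ ?_
    rw [tsum_mul_left, sub_le_comm, ← mul_sub]
    calc _ ≤ |c i * (L - ∑' r : Nat.Primes, (rootCount (f i) r : ℝ) * (r : ℝ) ^ (-s))| := le_abs_self _
      _ ≤ _ := by
        rw [abs_mul, abs_sub_comm]
        exact mul_le_mul_of_nonneg_left (hs i).2 (abs_nonneg _)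
  have hBs : Summable fun r : Nat.Primes ↦ if B r then (r : ℝ) ^ (-s) else 0 :=
    hs2.1.of_nonneg_of_le (fun r ↦ by positivity) fun r ↦ by
      split_ifs
      · exact le_rfl
      · positivity
  have hup : ∑' r : Nat.Primes, ∑ i, c i * ((rootCount (f i) r : ℝ) * (r : ℝ) ^ (-s)) ≤
      M * (∑' r : Nat.Primes, if B r then (r : ℝ) ^ (-s) else 0) + M * e := by
    rw [← tsum_mul_left, ← tsum_mul_left, ← (hBs.mul_left _).tsum_add (hEs.mul_left _)]
    refine Summable.tsum_le_tsum (fun r ↦ ?_) (summable_sum fun i _ ↦ (hs i).1.mul_left _)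
      ((hBs.mul_left _).add (hEs.mul_left _))
    simp_rw [← mul_assoc, ← Finset.sum_mul]
    have hr0 : 0 ≤ (r : ℝ) ^ (-s) := by positivity
    have hr1 : (r : ℝ) ^ (-s) ≤ 1 :=
      Real.rpow_le_one_of_one_le_of_nonpos (by exact_mod_cast r.2.one_le) (by linarith)
    have h1 := mul_le_mul_of_nonneg_right (hMle r r.2) hr0
    have h2 := mul_le_mul_of_nonneg_left hr1 hM0.le
    by_cases hBr : B r
    · rw [if_pos hBr]
      refine h1.trans (le_add_of_nonneg_right ?_)
      positivity
    · rw [if_neg hBr]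
      by_cases hEr : (r : ℕ) ∈ E
      · rw [if_pos hEr]; linarith
      · rw [if_neg hEr]
        have := mul_nonpos_of_nonpos_of_nonneg (hB r r.2 hEr hBr) hr0
        linarith
  have h1 := mul_le_mul_of_nonneg_left (h₀ s hs1) hM0.le
  have h2 := mul_le_mul_of_nonneg_left (abs_le.mp hs2.2).2 (show 0 ≤ c₀ / 2 by positivity)
  have h3 : M * (c₀ / (2 * M) * ∑' r : Nat.Primes, (r : ℝ) ^ (-s) + C₀) =
      c₀ / 2 * ∑' r : Nat.Primes, (r : ℝ) ^ (-s) + M * C₀ := by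
    field_simp
  rw [h3] at h1
  have h4 : c₀ / 2 * C₁ + M * C₀ + M * e + ∑ i, |c i| * C i < c₀ / 2 * L := by
    have := mul_lt_mul_of_pos_left hs3 (show 0 < c₀ / 2 by positivity)
    rwa [← mul_assoc, show c₀ / 2 * (2 / c₀) = 1 by field_simp, one_mul] at this
  linarith

theorem mul_card_filter_dotProduct_le {q k : ℕ} [Fact q.Prime] {x v : Fin k → ZMod q} (hx : x ≠ 0)
    (h : ∀ c : ZMod q, c ≠ 0 → v ≠ c • x) :
    q * (Finset.univ.filter fun w : Fin k → ZMod q ↦ w ⬝ᵥ x = 0 ∧ w ⬝ᵥ v = 0).card ≤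
      (Finset.univ.filter fun w : Fin k → ZMod q ↦ w ⬝ᵥ v = 0).card := by
  have key : ∃ w₀ : Fin k → ZMod q, w₀ ⬝ᵥ v = 0 ∧ w₀ ⬝ᵥ x ≠ 0 := by
    by_contra! hw
    obtain ⟨i, hi⟩ := Function.ne_iff.mp hx
    have hv : v ≠ 0 := by
      rintro rfl
      exact hi (by simpa using hw (Pi.single i 1) (by simp))
    obtain ⟨m, hm⟩ := Function.ne_iff.mp hv
    have hcross : ∀ t, v m * x t = v t * x m := fun t ↦ by
      have := hw (Pi.single t (v m) - Pi.single m (v t)) (by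
        rw [sub_dotProduct, single_dotProduct, single_dotProduct]; ring)
      rw [sub_dotProduct, single_dotProduct, single_dotProduct] at this
      exact sub_eq_zero.mp this
    have hxm : x m ≠ 0 := fun h0 ↦ by
      have := hcross i
      rw [h0, mul_zero] at this
      exact (mul_ne_zero hm hi) this
    refine h (v m / x m) (div_ne_zero hm hxm) (funext fun t ↦ ?_)
    rw [Pi.smul_apply, smul_eq_mul, div_mul_eq_mul_div, hcross, mul_div_cancel_right₀ _ hxm]
  obtain ⟨w₀, h₁, h₂⟩ := key
  refine (show _ = ((Finset.univ : Finset (ZMod q)) ×ˢ Finset.univ.filter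
    fun w : Fin k → ZMod q ↦ w ⬝ᵥ x = 0 ∧ w ⬝ᵥ v = 0).card by
      rw [Finset.card_product, Finset.card_univ, ZMod.card]).trans_le ?_
  refine Finset.card_le_card_of_injOn (fun y ↦ y.2 + y.1 • w₀) (fun y hy ↦ ?_) ?_
  · simp only [Finset.coe_product, Set.mem_prod, Finset.mem_coe, Finset.mem_filter,
      Finset.mem_univ, true_and] at hy ⊢
    rw [add_dotProduct, smul_dotProduct, hy.2, h₁, smul_zero, add_zero]
  · rintro ⟨c, w⟩ hy ⟨d, u⟩ hz hyz
    simp only [Finset.coe_product, Set.mem_prod, Finset.mem_coe, Finset.mem_filter,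
      Finset.mem_univ, true_and] at hy hz hyz
    have h3 := congrArg (· ⬝ᵥ x) hyz
    simp only [add_dotProduct, smul_dotProduct, hy.1, hz.1, zero_add, smul_eq_mul] at h3
    obtain rfl := mul_right_cancel₀ h₂ h3
    rw [add_left_inj] at hyz
    rw [hyz]

/-- In a finite cyclic group, the `q`-th powers form the kernel of a character of order
dividing `q`. -/
theorem IsCyclic.exists_monoidHom_eq_one_iff (G : Type*) [CommGroup G] [Finite G] [IsCyclic G]
    {q : ℕ} (hq : q.Prime) :
    ∃ φ : G →* Multiplicative (ZMod q), ∀ u, φ u = 1 ↔ ∃ y, y ^ q = u := by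
  by_cases h : q ∣ Nat.card G
  · let e := zmodCyclicMulEquiv (G := G) inferInstance
    refine ⟨(AddMonoidHom.toMultiplicative (ZMod.castHom h (ZMod q)).toAddMonoidHom).comp
      e.symm.toMonoidHom, fun u ↦ ⟨fun hu ↦ ?_, ?_⟩⟩
    · obtain ⟨z, rfl⟩ := e.surjective u
      obtain ⟨m, hm⟩ := ZMod.intCast_surjective z.toAdd
      have h1 : ZMod.castHom h (ZMod q) z.toAdd = 0 := by
        have := congrArg Multiplicative.toAdd hu
        simpa using this
      rw [← hm, map_intCast, ZMod.intCast_zmod_eq_zero_iff_dvd] at h1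
      obtain ⟨t, rfl⟩ := h1
      refine ⟨e (Multiplicative.ofAdd (t : ZMod (Nat.card G))), ?_⟩
      rw [← map_pow, ← ofAdd_nsmul, nsmul_eq_mul]
      congr 1
      rw [← ofAdd_toAdd z, ← hm]
      push_cast
      rfl
    · rintro ⟨y, rfl⟩
      rw [map_pow, ← ofAdd_toAdd (MonoidHom.comp _ _ y), ← ofAdd_nsmul, nsmul_eq_mul,
        CharP.cast_eq_zero, zero_mul, ofAdd_zero]
  · refine ⟨1, fun u ↦ ⟨fun _ ↦ ?_, fun _ ↦ rfl⟩⟩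
    exact (powCoprime ((hq.coprime_iff_not_dvd.mpr h).symm)).surjective u

theorem card_pow_eq_of_monoidHom {r q : ℕ} [Fact r.Prime] (hq : q ≠ 0)
    {φ : (ZMod r)ˣ →* Multiplicative (ZMod q)} (hφ : ∀ u, φ u = 1 ↔ ∃ y, y ^ q = u) (u : (ZMod r)ˣ) :
    Nat.card {y : ZMod r // y ^ q = u} =
      if φ u = 1 then Nat.card {y : ZMod r // y ^ q = 1} else 0 := by
  split_ifs with h
  · obtain ⟨z, hz⟩ := (hφ u).mp h
    have hz' : (z : ZMod r) ^ q = u := by rw [← hz, Units.val_pow_eq_pow_val]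
    refine Nat.card_congr ((Units.mulLeft z⁻¹).subtypeEquiv fun y ↦ ?_)
    rw [Units.mulLeft_apply, mul_pow, ← hz', ← Units.val_pow_eq_pow_val, ← Units.val_pow_eq_pow_val,
      inv_pow, Units.inv_mul_eq_one, eq_comm]
  · rw [Nat.card_eq_zero]
    left
    refine ⟨fun y ↦ h ((hφ u).mpr ?_)⟩
    have hy : (y : ZMod r) ≠ 0 := by
      intro h0
      have := y.2
      rw [h0, zero_pow hq] at this
      exact u.ne_zero this.symm
    exact ⟨Units.mk0 y hy, Units.ext (by simpa using y.2)⟩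

theorem rootCount_X_pow_sub_C (q : ℕ) (n : ℤ) (r : ℕ) :
    rootCount (X ^ q - C n) r = Nat.card {y : ZMod r // y ^ q = n} := by
  refine Nat.card_congr (Equiv.subtypeEquivRight fun y ↦ ?_)
  simp [sub_eq_zero]

theorem rootCount_cyclotomic_add_one {q r : ℕ} (hq : q.Prime) [hr : Fact r.Prime] (hqr : r ≠ q) :
    rootCount (cyclotomic q ℤ) r + 1 = Nat.card {y : ZMod r // y ^ q = 1} := by
  classical
  have := Fact.mk hq
  have hq0 : (q : ZMod r) ≠ 0 := by
    rw [Ne, ZMod.natCast_eq_zero_iff]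
    exact fun h ↦ hqr ((Nat.prime_dvd_prime_iff_eq hr.out hq).mp h)
  rw [rootCount, map_cyclotomic]
  rw [Nat.card_eq_fintype_card, Nat.card_eq_fintype_card, Fintype.card_subtype, Fintype.card_subtype,
    ← Finset.card_insert_of_notMem (a := (1 : ZMod r)) (by
      simpa [IsRoot.def, eval_one_cyclotomic_prime] using hq0)]
  congr 1
  ext y
  have := congrArg (eval y) (cyclotomic_prime_mul_X_sub_one (ZMod r) q)
  simp only [eval_mul, eval_sub, eval_X, eval_one, eval_pow] at this
  rw [Finset.mem_insert, Finset.mem_filter, Finset.mem_filter, ← sub_eq_zero (a := y ^ q), ← this,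
    mul_eq_zero, sub_eq_zero, IsRoot.def]
  simp [or_comm]

theorem Nat.exists_eq_prod_mul_pow {k q n : ℕ} {p : Fin k → ℕ}
    (hinj : Function.Injective p) (hn : n ≠ 0)
    (h : ∀ r : ℕ, r.Prime → ¬ q ∣ n.factorization r → ∃ i, p i = r) :
    ∃ t : ℕ, n = (∏ i, p i ^ (n.factorization (p i) % q)) * t ^ q := by
  classical
  set S := n.primeFactors ∪ Finset.univ.image p with hS
  refine ⟨∏ r ∈ S, r ^ (n.factorization r / q), ?_⟩
  have h1 : n = ∏ r ∈ S, r ^ n.factorization r := by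
    conv_lhs => rw [← Nat.prod_factorization_pow_eq_self hn]
    exact Finsupp.prod_of_support_subset _ Finset.subset_union_left _ fun _ _ ↦ pow_zero _
  have h2 : ∏ i, p i ^ (n.factorization (p i) % q) = ∏ r ∈ S, r ^ (n.factorization r % q) := by
    rw [← Finset.prod_image (s := Finset.univ) (g := p) (f := fun r ↦ r ^ (n.factorization r % q))
      hinj.injOn]
    refine Finset.prod_subset Finset.subset_union_right fun r hr hr' ↦ ?_
    have hrp : r.Prime := by
      rcases Finset.mem_union.mp hr with h | h
      · exact Nat.prime_of_mem_primeFactors h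
      · exact absurd h hr'
    have hdvd : q ∣ n.factorization r := by
      by_contra hd
      obtain ⟨i, hi⟩ := h r hrp hd
      exact hr' (Finset.mem_image.mpr ⟨i, Finset.mem_univ _, hi⟩)
    rw [Nat.mod_eq_zero_of_dvd hdvd, pow_zero]
  rw [h2, ← Finset.prod_pow, ← Finset.prod_mul_distrib]
  conv_lhs => rw [h1]
  refine Finset.prod_congr rfl fun r _ ↦ ?_
  rw [← pow_mul, ← pow_add, mul_comm, Nat.mod_add_div]

theorem Int.exists_eq_prod_mul_pow {k q : ℕ} {a : ℤ} (hq : Odd q) {p : Fin k → ℕ}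
    (hinj : Function.Injective p) (ha : a ≠ 0)
    (h : ∀ r : ℕ, r.Prime → ¬ q ∣ a.natAbs.factorization r → ∃ i, p i = r) :
    ∃ t : ℤ, a = (∏ i, p i ^ (a.natAbs.factorization (p i) % q) : ℕ) * t ^ q := by
  obtain ⟨t, ht⟩ := Nat.exists_eq_prod_mul_pow hinj (Int.natAbs_ne_zero.mpr ha) h
  have ht' : (a.natAbs : ℤ) = (∏ i, p i ^ (a.natAbs.factorization (p i) % q) : ℕ) * (t : ℤ) ^ q := by
    exact_mod_cast ht
  rcases Int.natAbs_eq a with h | h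
  · exact ⟨t, h.trans ht'⟩
  · exact ⟨-t, by rw [hq.neg_pow, mul_neg, ← ht']; exact h⟩

theorem irreducible_X_pow_sub_C_prod {q k : ℕ} (hq : q.Prime) {p : Fin k → ℕ}
    (hp : ∀ i, (p i).Prime) (hinj : Function.Injective p) {e : Fin k → ℕ} {i : Fin k}
    (he : ¬ q ∣ e i) : Irreducible (X ^ q - C ((∏ i, p i ^ e i : ℕ) : ℤ) : ℤ[X]) := by
  have hm : (X ^ q - C ((∏ i, p i ^ e i : ℕ) : ℤ) : ℤ[X]).Monic := monic_X_pow_sub_C _ hq.ne_zero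
  rw [hm.irreducible_iff_irreducible_map_fraction_map (K := ℚ)]
  simp only [Polynomial.map_sub, Polynomial.map_pow, map_X, map_C]
  refine X_pow_sub_C_irreducible_of_prime hq fun b hb ↦ he ?_
  have := Fact.mk (hp i)
  have hb' : b ^ q = ((∏ i, p i ^ e i : ℕ) : ℚ) := by simpa using hb
  have hn0 : ∏ i, p i ^ e i ≠ 0 := Finset.prod_ne_zero_iff.mpr fun i _ ↦ pow_ne_zero _ (hp i).ne_zero
  have h1 := congrArg (padicValRat (p i)) hb'
  rw [padicValRat.pow, padicValRat.of_nat, ← Nat.factorization_def _ (hp i)] at h1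
  have h2 : (∏ j, p j ^ e j).factorization (p i) = e i := by
    rw [Nat.factorization_prod fun j _ ↦ pow_ne_zero _ (hp j).ne_zero, Finset.sum_apply',
      Finset.sum_eq_single i]
    · simp [(hp i).factorization]
    · intro j _ hj
      simp [(hp j).factorization, hinj.ne hj]
    · simp
  rw [h2] at h1
  exact Int.natCast_dvd_natCast.mp ⟨_, h1.symm⟩

/-- At a prime `r` different from all `p i`, being a `q`-th power modulo `r` is a linear condition
on exponent vectors. -/
theorem exists_vector_pow_residue {q r k : ℕ} (hq : q.Prime) (hr : r.Prime) {p : Fin k → ℕ}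
    (hp : ∀ i, (p i).Prime) (hpr : ∀ i, p i ≠ r) :
    ∃ v : Fin k → ZMod q,
      (∀ e : Fin k → ℕ, Nat.card {y : ZMod r // y ^ q = ((∏ i, p i ^ e i : ℕ) : ZMod r)} =
        if ∑ i, (e i : ZMod q) * v i = 0 then Nat.card {y : ZMod r // y ^ q = 1} else 0) ∧
      ∀ (e : Fin k → ℕ) (t : ℤ), ¬ (r : ℤ) ∣ (∏ i, p i ^ e i : ℕ) * t ^ q →
        ((∃ x : ℤ, (r : ℤ) ∣ x ^ q - (∏ i, p i ^ e i : ℕ) * t ^ q) ↔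
          ∑ i, (e i : ZMod q) * v i = 0) := by
  have := Fact.mk hr
  obtain ⟨φ, hφ⟩ := IsCyclic.exists_monoidHom_eq_one_iff (ZMod r)ˣ hq
  have hp0 : ∀ i, (p i : ZMod r) ≠ 0 := fun i ↦ by
    rw [Ne, ZMod.natCast_eq_zero_iff]
    exact fun h ↦ hpr i ((Nat.prime_dvd_prime_iff_eq hr (hp i)).mp h).symm
  let u : Fin k → (ZMod r)ˣ := fun i ↦ Units.mk0 (p i) (hp0 i)
  have hu : ∀ e : Fin k → ℕ, ((∏ i, p i ^ e i : ℕ) : ZMod r) = ((∏ i, u i ^ e i : (ZMod r)ˣ) : ZMod r) :=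
    fun e ↦ by simp [u]
  have hφu : ∀ e : Fin k → ℕ, φ (∏ i, u i ^ e i) = 1 ↔ ∑ i, (e i : ZMod q) * (φ (u i)).toAdd = 0 := by
    intro e
    rw [map_prod, ← toAdd_eq_zero, toAdd_prod]
    simp [map_pow, toAdd_pow, nsmul_eq_mul]
  refine ⟨fun i ↦ (φ (u i)).toAdd, fun e ↦ ?_, fun e t ht ↦ ?_⟩
  · rw [hu, card_pow_eq_of_monoidHom hq.ne_zero hφ]
    simp only [hφu]
  · rw [← hφu, hφ]
    have ht0 : (t : ZMod r) ≠ 0 := by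
      rw [Ne, ZMod.intCast_zmod_eq_zero_iff_dvd]
      exact fun h ↦ ht ((h.trans (dvd_pow_self t hq.ne_zero)).mul_left _)
    have hx : ∀ x : ℤ, (r : ℤ) ∣ x ^ q - (∏ i, p i ^ e i : ℕ) * t ^ q ↔
        (x : ZMod r) ^ q = ((∏ i, u i ^ e i : (ZMod r)ˣ) : ZMod r) * (t : ZMod r) ^ q := by
      intro x
      rw [← ZMod.intCast_zmod_eq_zero_iff_dvd, Int.cast_sub, sub_eq_zero, Int.cast_mul,
        Int.cast_pow, Int.cast_pow, Int.cast_natCast, hu]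
    constructor
    · rintro ⟨x, h⟩
      rw [hx] at h
      have hx0 : (x : ZMod r) ≠ 0 := fun h0 ↦ by
        rw [h0, zero_pow hq.ne_zero] at h
        exact mul_ne_zero (Units.ne_zero _) (pow_ne_zero _ ht0) h.symm
      refine ⟨Units.mk0 (x : ZMod r) hx0 / Units.mk0 (t : ZMod r) ht0, ?_⟩
      rw [div_pow, div_eq_iff_eq_mul]
      exact Units.ext h
    · rintro ⟨y, hy⟩
      obtain ⟨x, hxy⟩ := ZMod.intCast_surjective ((y : ZMod r) * (t : ZMod r))
      refine ⟨x, (hx x).mpr ?_⟩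
      rw [hxy, mul_pow, ← hy, Units.val_pow_eq_pow_val]

theorem card_le_mul_card_filter_dotProduct {q k : ℕ} [Fact q.Prime] {x : Fin k → ZMod q}
    (hx : x ≠ 0) : Fintype.card (Fin k → ZMod q) ≤
      q * (Finset.univ.filter fun w : Fin k → ZMod q ↦ w ⬝ᵥ x = 0).card := by
  obtain ⟨i, hi⟩ := Function.ne_iff.mp hx
  rw [show q * _ = ((Finset.univ : Finset (ZMod q)) ×ˢ Finset.univ.filter
    fun w : Fin k → ZMod q ↦ w ⬝ᵥ x = 0).card by
      rw [Finset.card_product, Finset.card_univ, ZMod.card], ← Finset.card_univ]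
  refine Finset.card_le_card_of_injOn
    (fun w ↦ (w ⬝ᵥ x, w - Pi.single i (w ⬝ᵥ x / x i))) (fun w _ ↦ ?_) fun w _ u _ h ↦ ?_
  · simp only [Finset.coe_product, Set.mem_prod, Finset.mem_coe, Finset.mem_filter,
      Finset.mem_univ, true_and]
    rw [sub_dotProduct, single_dotProduct, div_mul_cancel₀ _ hi, sub_self]
  · simp only [Prod.mk.injEq] at h
    rw [h.1] at h
    exact sub_left_injective h.2

theorem not_density_zero_of_forall_sum_ne_zero {q k l : ℕ} (hq : q.Prime) {p : Fin k → ℕ}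
    (hp : ∀ i, (p i).Prime) (hinj : Function.Injective p) {a : Fin l → ℤ} (ha : ∀ j, a j ≠ 0)
    {e : Fin k → Fin l → ℕ} (hae : ∀ j, ∃ t : ℤ, a j = (∏ i, p i ^ e i j : ℕ) * t ^ q)
    {x : Fin k → ZMod q} (hx : x ≠ 0) (hxe : ∀ j, ∑ i, (e i j : ZMod q) * x i ≠ 0)
    (B : ℕ → Prop) [DecidablePred B]
    (hB : ∀ r, r.Prime → ¬ B r → ∃ j, ∃ x : ℤ, (r : ℤ) ∣ x ^ q - a j) :
    ¬ Tendsto (fun N : ℕ ↦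
      ((Finset.filter (fun r : ℕ ↦ r.Prime ∧ B r) (Finset.range (N + 1))).card : ℝ) /
        ((Finset.filter Nat.Prime (Finset.range (N + 1))).card : ℝ)) atTop (𝓝 0) := by
  have := Fact.mk hq
  have hq2 : (2 : ℝ) ≤ q := by exact_mod_cast hq.two_le
  let n : (Fin k → ZMod q) → ℕ := fun w ↦ ∏ i, p i ^ (w i).val
  let f : {w : Fin k → ZMod q // w ≠ 0} ⊕ Bool → ℤ[X] :=
    Sum.elim (fun w ↦ X ^ q - C (n w : ℤ)) fun b ↦ bif b then cyclotomic q ℤ else X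
  let d : (Fin k → ZMod q) → ℝ := fun w ↦ q * (if w ⬝ᵥ x = 0 then 1 else 0) - 1
  let c : {w : Fin k → ZMod q // w ≠ 0} ⊕ Bool → ℝ := Sum.elim (fun w ↦ d w) fun _ ↦ q - 1
  have hd0 : d 0 = q - 1 := by simp [d]
  have hm : ∀ i, (f i).Monic := by
    rintro (w | _ | _)
    · exact monic_X_pow_sub_C _ hq.ne_zero
    · exact monic_X
    · exact cyclotomic.monic q ℤ
  have hf : ∀ i, Irreducible (f i) := by
    rintro (⟨w, hw⟩ | _ | _)
    · obtain ⟨i, hi⟩ := Function.ne_iff.mp hw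
      refine irreducible_X_pow_sub_C_prod hq hp hinj (i := i) fun h ↦ hi ?_
      rw [← ZMod.natCast_eq_zero_iff, ZMod.natCast_zmod_val] at h
      exact h
    · exact irreducible_X
    · exact cyclotomic.irreducible hq.pos
  have hc : 0 < ∑ i, c i := by
    have h1 : 0 ≤ ∑ w, d w := by
      simp only [d, Finset.sum_sub_distrib, ← Finset.mul_sum, Finset.sum_boole]
      rw [sub_nonneg, Finset.sum_const, nsmul_eq_mul, mul_one, Finset.card_univ]
      exact_mod_cast card_le_mul_card_filter_dotProduct hx
    rw [Fintype.sum_eq_add_sum_subtype_ne d 0, hd0] at h1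
    rw [Fintype.sum_sum_type, Fintype.sum_bool]
    simp only [c, Sum.elim_inl, Sum.elim_inr]
    linarith
  refine not_density_zero_of_rootCount hm hf hc B
    (E := {q} ∪ Set.range p ∪ ⋃ j, ((a j).natAbs.divisors : Set ℕ)) ?_ fun r hr hrE hrB ↦ ?_
  · exact ((Set.finite_singleton q).union (Set.finite_range p)).union
      (Set.finite_iUnion fun j ↦ Finset.finite_toSet _)
  simp only [Set.mem_union, Set.mem_singleton_iff, Set.mem_range, Set.mem_iUnion, Finset.mem_coe,
    Nat.mem_divisors, not_or, not_exists] at hrE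
  obtain ⟨⟨hrq, hrp⟩, hra⟩ := hrE
  have := Fact.mk hr
  obtain ⟨v, hv₁, hv₂⟩ := exists_vector_pow_residue hq hr hp hrp
  set m := Nat.card {y : ZMod r // y ^ q = 1} with hm'
  have hroot : ∀ w, rootCount (X ^ q - C (n w : ℤ)) r = if w ⬝ᵥ v = 0 then m else 0 := by
    intro w
    rw [rootCount_X_pow_sub_C, Int.cast_natCast, hv₁]
    simp only [ZMod.natCast_zmod_val]
    exact if_congr Iff.rfl rfl rfl
  have hsum : ∑ i, c i * rootCount (f i) r = ∑ w, d w * rootCount (X ^ q - C (n w : ℤ)) r := by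
    rw [Fintype.sum_sum_type, Fintype.sum_bool, Fintype.sum_eq_add_sum_subtype_ne
      (fun w ↦ d w * (rootCount (X ^ q - C (n w : ℤ)) r : ℝ)) 0, hd0, hroot 0,
      zero_dotProduct, if_pos rfl, hm', ← rootCount_cyclotomic_add_one hq hrq]
    simp only [c, f, Sum.elim_inl, Sum.elim_inr, cond_true, cond_false, rootCount_X]
    push_cast
    ring
  rw [hsum]
  have hle : q * (Finset.univ.filter fun w : Fin k → ZMod q ↦ w ⬝ᵥ x = 0 ∧ w ⬝ᵥ v = 0).card ≤
      (Finset.univ.filter fun w : Fin k → ZMod q ↦ w ⬝ᵥ v = 0).card := by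
    refine mul_card_filter_dotProduct_le hx fun b hb hvb ↦ ?_
    obtain ⟨j, hj⟩ := hB r hr hrB
    obtain ⟨t, ht⟩ := hae j
    have hnd : ¬ (r : ℤ) ∣ a j := fun h ↦
      hra j ⟨Int.natCast_dvd.mp h, Int.natAbs_ne_zero.mpr (ha j)⟩
    rw [ht] at hj hnd
    have h1 := (hv₂ (e · j) t hnd).mp hj
    simp only [hvb, Pi.smul_apply, smul_eq_mul, mul_left_comm _ b, ← Finset.mul_sum] at h1
    exact (mul_ne_zero hb (hxe j)) h1
  have heq : ∑ w, d w * rootCount (X ^ q - C (n w : ℤ)) r = m *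
      (q * (Finset.univ.filter fun w : Fin k → ZMod q ↦ w ⬝ᵥ x = 0 ∧ w ⬝ᵥ v = 0).card -
        (Finset.univ.filter fun w : Fin k → ZMod q ↦ w ⬝ᵥ v = 0).card) := by
    rw [← Finset.sum_boole, ← Finset.sum_boole, Finset.mul_sum, ← Finset.sum_sub_distrib,
      Finset.mul_sum]
    refine Finset.sum_congr rfl fun w _ ↦ ?_
    rw [hroot]
    by_cases h1 : w ⬝ᵥ x = 0 <;> by_cases h2 : w ⬝ᵥ v = 0 <;> simp [d, h1, h2, mul_comm]
  rw [heq]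
  refine mul_nonpos_of_nonneg_of_nonpos (by positivity) (sub_nonpos.mpr ?_)
  exact_mod_cast hle

theorem tendsto_primes_div_of_finite_compl (P : ℕ → Prop) [DecidablePred P] (T : Finset ℕ)
    (hP : ∀ r, r.Prime → r ∉ T → P r) :
    Tendsto (fun N : ℕ ↦
      ((Finset.filter (fun r : ℕ ↦ r.Prime ∧ P r) (Finset.range (N + 1))).card : ℝ) /
        ((Finset.filter Nat.Prime (Finset.range (N + 1))).card : ℝ)) atTop (𝓝 1) := by
  have hπ : ∀ N : ℕ, (Finset.filter Nat.Prime (Finset.range (N + 1))).card = Nat.primeCounting N :=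
    fun N ↦ (Nat.count_eq_card_filter_range _ _).symm
  have htop : Tendsto (fun N : ℕ ↦ ((Finset.filter Nat.Prime (Finset.range (N + 1))).card : ℝ))
      atTop atTop := by
    simp_rw [hπ]
    exact tendsto_natCast_atTop_atTop.comp Nat.tendsto_primeCounting
  have hlim : Tendsto (fun N : ℕ ↦ 1 - (T.card : ℝ) /
      ((Finset.filter Nat.Prime (Finset.range (N + 1))).card : ℝ)) atTop (𝓝 1) := by
    simpa using tendsto_const_nhds.sub (htop.const_div_atTop (T.card : ℝ))
  refine tendsto_of_tendsto_of_tendsto_of_le_of_le' hlim tendsto_const_nhds ?_ ?_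
  · filter_upwards [htop.eventually_gt_atTop 0] with N hN
    rw [one_sub_div hN.ne']
    refine div_le_div_of_nonneg_right ?_ hN.le
    rw [sub_le_iff_le_add]
    have : (Finset.filter Nat.Prime (Finset.range (N + 1))).card ≤
        (Finset.filter (fun r : ℕ ↦ r.Prime ∧ P r) (Finset.range (N + 1))).card + T.card := by
      refine (Finset.card_le_card fun r hr ↦ ?_).trans (Finset.card_union_le _ _)
      rw [Finset.mem_filter] at hr
      by_cases hrT : r ∈ T
      · exact Finset.mem_union_right _ hrT
      · exact Finset.mem_union_left _ (Finset.mem_filter.mpr ⟨hr.1, hr.2, hP r hr.2 hrT⟩)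
    exact_mod_cast this
  · filter_upwards with N
    refine div_le_one_of_le₀ ?_ (by positivity)
    have : (Finset.filter (fun r : ℕ ↦ r.Prime ∧ P r) (Finset.range (N + 1))).card ≤
        (Finset.filter Nat.Prime (Finset.range (N + 1))).card :=
      Finset.card_le_card (Finset.monotone_filter_right _ fun _ _ h ↦ h.1)
    exact_mod_cast this

theorem tendsto_primes_div_compl (P : ℕ → Prop) [DecidablePred P]
    (h : Tendsto (fun N : ℕ ↦
      ((Finset.filter (fun r : ℕ ↦ r.Prime ∧ P r) (Finset.range (N + 1))).card : ℝ) /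
        ((Finset.filter Nat.Prime (Finset.range (N + 1))).card : ℝ)) atTop (𝓝 1)) :
    Tendsto (fun N : ℕ ↦
      ((Finset.filter (fun r : ℕ ↦ r.Prime ∧ ¬ P r) (Finset.range (N + 1))).card : ℝ) /
        ((Finset.filter Nat.Prime (Finset.range (N + 1))).card : ℝ)) atTop (𝓝 0) := by
  have h1 := (tendsto_const_nhds (x := (1 : ℝ))).sub h
  rw [sub_self] at h1
  refine h1.congr' ?_
  filter_upwards [eventually_ge_atTop 2] with N hN
  have hpos : 0 < (Finset.filter Nat.Prime (Finset.range (N + 1))).card :=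
    Finset.card_pos.mpr ⟨2, Finset.mem_filter.mpr ⟨Finset.mem_range.mpr (by omega), Nat.prime_two⟩⟩
  have hcard := Finset.card_filter_add_card_filter_not (s := Finset.filter Nat.Prime
    (Finset.range (N + 1))) P
  rw [Finset.filter_filter, Finset.filter_filter] at hcard
  rw [one_sub_div (by exact_mod_cast hpos.ne'), ← hcard]
  push_cast
  ring

end

open scoped Classical

/-- Characterization of finite sets of nonzero integers (containing no perfect
q-th power) that contain a q-th power residue modulo almost every prime. -/
theorem stmt2 (q : ℕ) (hq : q.Prime) (hq_odd : Odd q)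
    (l : ℕ) (hl : 1 ≤ l) (a : Fin l → ℤ)
    (ha0 : ∀ j, a j ≠ 0)
    (hanp : ∀ j, ¬ ∃ b : ℤ, a j = b ^ q)
    (k : ℕ) (hk : 2 ≤ k) (p : Fin k → ℕ)
    (hp : ∀ i, (p i).Prime) (hpinj : Function.Injective p)
    (hpall : ∀ r : ℕ, r.Prime →
      ((∃ j, ¬ (q ∣ (a j).natAbs.factorization r)) ↔ ∃ i, p i = r))
    (ν : Fin k → Fin l → ℕ)
    (hν : ∀ i j, ν i j = (a j).natAbs.factorization (p i) % q) :
    ((Filter.Tendsto (fun N : ℕ =>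
        ((Finset.filter (fun r : ℕ => r.Prime ∧ ∃ j, ∃ x : ℤ, (r : ℤ) ∣ x ^ q - a j)
          (Finset.range (N + 1))).card : ℝ) /
        ((Finset.filter Nat.Prime (Finset.range (N + 1))).card : ℝ))
        Filter.atTop (nhds 1)) ↔
      (∀ r : ℕ, r.Prime → r ≠ q → (∀ i, p i ≠ r) →
        ∃ j, ∃ x : ℤ, (r : ℤ) ∣ x ^ q - a j)) ∧
    ((∀ r : ℕ, r.Prime → r ≠ q → (∀ i, p i ≠ r) →
        ∃ j, ∃ x : ℤ, (r : ℤ) ∣ x ^ q - a j) ↔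
      (∀ x : Fin k → ZMod q, ∃ j, ∑ i, (ν i j : ZMod q) * x i = 0)) := by
  have hae : ∀ j, ∃ t : ℤ, a j = (∏ i, p i ^ ν i j : ℕ) * t ^ q := fun j ↦ by
    simp only [hν]
    exact Int.exists_eq_prod_mul_pow hq_odd hpinj (ha0 j) fun r hr h ↦ (hpall r hr).mp ⟨j, h⟩
  have h21 (h : ∀ r : ℕ, r.Prime → r ≠ q → (∀ i, p i ≠ r) →
      ∃ j, ∃ x : ℤ, (r : ℤ) ∣ x ^ q - a j) :=
    tendsto_primes_div_of_finite_compl (fun r ↦ ∃ j, ∃ x : ℤ, (r : ℤ) ∣ x ^ q - a j)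
      (insert q (Finset.univ.image p)) fun r hr hrT ↦ by
        simp only [Finset.mem_insert, Finset.mem_image, Finset.mem_univ, true_and, not_or,
          not_exists] at hrT
        exact h r hr hrT.1 hrT.2
  have h32 (h : ∀ x : Fin k → ZMod q, ∃ j, ∑ i, (ν i j : ZMod q) * x i = 0) :
      ∀ r : ℕ, r.Prime → r ≠ q → (∀ i, p i ≠ r) → ∃ j, ∃ x : ℤ, (r : ℤ) ∣ x ^ q - a j := by
    intro r hr _ hrp
    obtain ⟨v, -, hv⟩ := exists_vector_pow_residue hq hr hp hrp
    obtain ⟨j, hj⟩ := h v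
    refine ⟨j, ?_⟩
    by_cases hd : (r : ℤ) ∣ a j
    · exact ⟨0, by rwa [zero_pow hq.ne_zero, zero_sub, dvd_neg]⟩
    · obtain ⟨t, ht⟩ := hae j
      rw [ht] at hd ⊢
      exact (hv (ν · j) t hd).mpr hj
  have h13 (h : Filter.Tendsto (fun N : ℕ =>
        ((Finset.filter (fun r : ℕ => r.Prime ∧ ∃ j, ∃ x : ℤ, (r : ℤ) ∣ x ^ q - a j)
          (Finset.range (N + 1))).card : ℝ) /
        ((Finset.filter Nat.Prime (Finset.range (N + 1))).card : ℝ)) Filter.atTop (nhds 1)) :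
      ∀ x : Fin k → ZMod q, ∃ j, ∑ i, (ν i j : ZMod q) * x i = 0 := by
    by_contra! hx
    obtain ⟨x, hx⟩ := hx
    have hx0 : x ≠ 0 := by
      rintro rfl
      exact hx ⟨0, hl⟩ (by simp)
    refine not_density_zero_of_forall_sum_ne_zero hq hp hpinj ha0 hae hx0 hx
      (fun r ↦ ¬ ∃ j, ∃ x : ℤ, (r : ℤ) ∣ x ^ q - a j) (fun r _ h ↦ not_not.mp h) ?_
    refine tendsto_primes_div_compl (fun r : ℕ ↦ ∃ j, ∃ x : ℤ, (r : ℤ) ∣ x ^ q - a j) ?_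
    convert h
  exact ⟨⟨fun h ↦ h32 (h13 h), fun h ↦ by convert h21 h⟩,
    ⟨fun h ↦ h13 (by convert h21 h), h32⟩⟩
end
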